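/- arXiv:1703.06340 — 2 statements merged into one kernel-verified Lean document; each statement's English description precedes it below -/
import Mathlib

section
/- (Converse Asgeirsson theorem for the B-ultrahyperbolic equation.) Let n = m' + m'', let γ', γ'' be multi-indices with all entries positive satisfying m' + |γ'| = m'' + |γ''|, and let u ∈ C²(ℝ^{m'}_+ × ℝ^{m''}_+) be even in each of its variables. If for every point (x,y) ∈ ℝ^{m'}_+ × ℝ^{m''}_+ and every r ≥ 0 one has M^{γ'}_u(x,r;y) = M^{γ''}_u(x;y,r), then u satisfies the B-ultrahyperbolic equation (Δ_{γ'})_x u = (Δ_{γ''})_y u in ℝ^{m'}_+ × ℝ^{m''}_+. -/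
open MeasureTheory Real Set Filter

noncomputable section

/-- The normalizing constant `C(ν) = Γ((ν+1)/2)/(√π Γ(ν/2))` of the generalized translation. -/
def transC (ν : ℝ) : ℝ := Real.Gamma ((ν + 1) / 2) / (Real.sqrt π * Real.Gamma (ν / 2))

/-- One-dimensional generalized translation generated by the Bessel operator `B_ν`. -/
def genTrans1 (ν x y : ℝ) (f : ℝ → ℝ) : ℝ :=
  transC ν * ∫ φ in (0:ℝ)..π,
    f (Real.sqrt (x ^ 2 + y ^ 2 - 2 * x * y * Real.cos φ)) * Real.sin φ ^ (ν - 1)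

/-- Multidimensional generalized translation `ᵞT^y`, the composition of the one-dimensional
generalized translations with parameters `γ i` in each variable (written as one iterated
integral). -/
def gT {n : ℕ} (γ : Fin n → ℝ) (y : Fin n → ℝ) (f : (Fin n → ℝ) → ℝ) (x : Fin n → ℝ) : ℝ :=
  (∏ i, transC (γ i)) *
    ∫ φ in Set.pi Set.univ (fun _ : Fin n => Set.Icc (0 : ℝ) π),
      f (fun i => Real.sqrt ((x i) ^ 2 + (y i) ^ 2 - 2 * x i * y i * Real.cos (φ i))) *
        ∏ i, Real.sin (φ i) ^ (γ i - 1)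

/-- The surface measure of the unit sphere of `ℝ^n`, viewed as a measure on the ambient space. -/
def sphereMeasure (n : ℕ) : Measure (EuclideanSpace ℝ (Fin n)) :=
  Measure.map Subtype.val ((volume : Measure (EuclideanSpace ℝ (Fin n))).toSphere)

/-- The (open) part `S_1^+(n)` of the unit sphere lying in `ℝ^n_+`, as a subset of `ℝ^n`. -/
def spherePlus (n : ℕ) : Set (EuclideanSpace ℝ (Fin n)) := {θ | ∀ i, 0 < θ i}

/-- The weighted area `|S_1^+(n)|_γ = ∫_{S_1^+(n)} θ^γ dS`. -/
def wArea (n : ℕ) (γ : Fin n → ℝ) : ℝ :=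
  ∫ θ in spherePlus n, (∏ i, θ i ^ γ i) ∂(sphereMeasure n)

/-- The weighted spherical mean
`M^γ_r[f](x) = |S_1^+(n)|_γ⁻¹ ∫_{S_1^+(n)} (ᵞT^{rθ}f)(x) θ^γ dS`. -/
def wMean {n : ℕ} (γ : Fin n → ℝ) (f : (Fin n → ℝ) → ℝ) (x : Fin n → ℝ) (r : ℝ) : ℝ :=
  (wArea n γ)⁻¹ *
    ∫ θ in spherePlus n, gT γ (fun i => r * θ i) f x * ∏ i, θ i ^ γ i ∂(sphereMeasure n)

/-- Partial derivative in the `i`-th coordinate. -/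
def pderiv' {n : ℕ} (i : Fin n) (f : (Fin n → ℝ) → ℝ) (x : Fin n → ℝ) : ℝ :=
  deriv (fun t => f (Function.update x i t)) (x i)

/-- The Laplace–Bessel operator `Δ_γ = Σ_i (∂²/∂x_i² + (γ_i/x_i) ∂/∂x_i)`. -/
def laplaceBessel {n : ℕ} (γ : Fin n → ℝ) (f : (Fin n → ℝ) → ℝ) (x : Fin n → ℝ) : ℝ :=
  ∑ i, (pderiv' i (pderiv' i f) x + γ i / x i * pderiv' i f x)

/-- Euclidean norm on `Fin n → ℝ`. -/
def euclNorm {n : ℕ} (x : Fin n → ℝ) : ℝ := Real.sqrt (∑ i, (x i) ^ 2)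

section Aux

lemma sin_int (ν : ℝ) (hν : 0 < ν) :
    ∫ φ in Set.Icc (0:ℝ) π, Real.sin φ ^ (ν - 1) =
      Real.sqrt π * Real.Gamma (ν / 2) / Real.Gamma ((ν + 1) / 2) := by
  have h1 : ∀ q : ℝ, -1 < q →
      ∫ x in Ioi (0:ℝ), x ^ q * Real.exp (-x ^ 2) = Real.Gamma ((q + 1) / 2) / 2 := by
    intro q hq
    have := integral_rpow_mul_exp_neg_rpow (p := 2) (q := q) (by norm_num) hq
    simp only [Real.rpow_two] at this
    rw [this]; ring
  have hg : ∫ x : ℝ, Real.exp (-x ^ 2) = Real.sqrt π := by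
    have := integral_gaussian 1
    simpa using this
  have key := integral_comp_polarCoord_symm
    (fun p : ℝ × ℝ => Real.exp (-p.1 ^ 2) *
      (Ioi (0:ℝ)).indicator (fun t => t ^ (ν - 1) * Real.exp (-t ^ 2)) p.2)
  rw [Measure.volume_eq_prod, integral_prod_mul (fun x : ℝ => Real.exp (-x ^ 2))
    ((Ioi (0:ℝ)).indicator (fun t => t ^ (ν - 1) * Real.exp (-t ^ 2))),
    integral_indicator measurableSet_Ioi, hg, h1 _ (by linarith)] at key
  have e2 : ∫ p in polarCoord.target, p.1 • (fun p : ℝ × ℝ => Real.exp (-p.1 ^ 2) *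
      (Ioi (0:ℝ)).indicator (fun t => t ^ (ν - 1) * Real.exp (-t ^ 2)) p.2) (polarCoord.symm p)
      ∂((volume : Measure ℝ).prod volume)
      = ∫ p in Ioi (0 : ℝ) ×ˢ Ioo (-π) π, (p.1 ^ ν * Real.exp (-p.1 ^ 2)) *
        ((Ioo (0:ℝ) π).indicator (fun φ => Real.sin φ ^ (ν - 1)) p.2)
        ∂((volume : Measure ℝ).prod volume) := by
    refine setIntegral_congr_fun (measurableSet_Ioi.prod measurableSet_Ioo) ?_
    rintro ⟨r, φ⟩ ⟨hr, hφ⟩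
    simp only [mem_Ioi] at hr
    simp only [polarCoord_symm_apply, smul_eq_mul]
    by_cases h : 0 < φ
    · have hs : 0 < Real.sin φ := Real.sin_pos_of_pos_of_lt_pi h hφ.2
      rw [indicator_of_mem (show r * Real.sin φ ∈ Ioi (0:ℝ) from mul_pos hr hs),
        indicator_of_mem (show φ ∈ Ioo 0 π from ⟨h, hφ.2⟩), Real.mul_rpow hr.le hs.le]
      have : -r ^ 2 = -(r * Real.cos φ)^2 + -(r * Real.sin φ)^2 := by
        nlinarith [Real.sin_sq_add_cos_sq φ]
      rw [this, Real.exp_add]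
      have h3 : r ^ ν = r * r ^ (ν - 1) := by
        rw [Real.rpow_sub_one hr.ne']; field_simp
      rw [h3]; ring
    · have hs : Real.sin φ ≤ 0 := Real.sin_nonpos_of_nonpos_of_neg_pi_le (not_lt.1 h) hφ.1.le
      rw [indicator_of_notMem, indicator_of_notMem]
      · ring
      · exact fun h' => h h'.1
      · simp only [mem_Ioi, not_lt]; exact mul_nonpos_of_nonneg_of_nonpos hr.le hs
  rw [e2, setIntegral_prod_mul (fun r : ℝ => r ^ ν * Real.exp (-r ^ 2)), h1 _ (by linarith),
    setIntegral_indicator measurableSet_Ioo,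
    show Ioo (-π) π ∩ Ioo 0 π = Ioo 0 π from
      inter_eq_right.2 (Ioo_subset_Ioo_left (by linarith [Real.pi_pos])),
    ← integral_Icc_eq_integral_Ioo, sub_add_cancel] at key
  have hG : 0 < Real.Gamma ((ν + 1) / 2) := Real.Gamma_pos_of_pos (by linarith)
  field_simp
  linarith

lemma wArea_formula (n : ℕ) (hn : 0 < n) (δ : Fin n → ℝ) (hδ : ∀ i, 0 < δ i) :
    wArea n δ * (Real.Gamma (((n:ℝ) + ∑ i, δ i) / 2) / 2) =
      ∏ i, (Real.Gamma ((δ i + 1) / 2) / 2) := by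
  have h1 : ∀ q : ℝ, -1 < q →
      ∫ x in Ioi (0:ℝ), x ^ q * Real.exp (-x ^ 2) = Real.Gamma ((q + 1) / 2) / 2 := by
    intro q hq
    have := integral_rpow_mul_exp_neg_rpow (p := 2) (q := q) (by norm_num) hq
    simp only [Real.rpow_two] at this
    rw [this]; ring
  have hS : 0 ≤ ∑ i, δ i := Finset.sum_nonneg fun i _ => (hδ i).le
  have : Nonempty (Fin n) := ⟨⟨0, hn⟩⟩
  have : Nontrivial (EuclideanSpace ℝ (Fin n)) := inferInstance
  set h : Fin n → ℝ → ℝ := fun i =>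
    (Ioi (0:ℝ)).indicator (fun t => t ^ δ i * Real.exp (-t ^ 2)) with hh
  have e1 : ∫ z : EuclideanSpace ℝ (Fin n), ∏ i, h i (z i) =
      ∏ i, (Real.Gamma ((δ i + 1) / 2) / 2) := by
    rw [← (PiLp.volume_preserving_toLp (Fin n)).integral_comp
      (MeasurableEquiv.toLp 2 (Fin n → ℝ)).measurableEmbedding]
    have := integral_fintype_prod_volume_eq_prod (𝕜 := ℝ) h
    rw [this]
    refine Finset.prod_congr rfl fun i _ => ?_
    rw [hh]; simp only
    rw [integral_indicator measurableSet_Ioi, h1 _ (by linarith [hδ i])]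
  rw [← e1]
  have e2 : ∫ z : EuclideanSpace ℝ (Fin n), ∏ i, h i (z i) =
      ∫ p : (Metric.sphere (0 : EuclideanSpace ℝ (Fin n)) 1) × Ioi (0:ℝ),
        (((Subtype.val ⁻¹' (spherePlus n)).indicator
          (fun θ => ∏ i, (θ.1 i) ^ δ i) : Metric.sphere (0 : EuclideanSpace ℝ (Fin n)) 1 → ℝ) p.1) *
          (p.2.1 ^ (∑ i, δ i) * Real.exp (-p.2.1 ^ 2))
        ∂((volume : Measure (EuclideanSpace ℝ (Fin n))).toSphere.prod
          (Measure.volumeIoiPow (Module.finrank ℝ (EuclideanSpace ℝ (Fin n)) - 1))) := by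
    rw [← (Measure.measurePreserving_homeomorphUnitSphereProd
      (volume : Measure (EuclideanSpace ℝ (Fin n)))).integral_comp
        (Homeomorph.measurableEmbedding _)]
    have : ∫ z : EuclideanSpace ℝ (Fin n), ∏ i, h i (z i) =
        ∫ z in ({0}ᶜ : Set (EuclideanSpace ℝ (Fin n))), ∏ i, h i (z i) := by
      rw [restrict_compl_singleton]
    rw [this, ← integral_subtype_comap (measurableSet_singleton _).compl]
    refine integral_congr_ae (Eventually.of_forall ?_)
    rintro ⟨z, hz⟩
    simp only
    have hz0 : 0 < ‖z‖ := norm_pos_iff.2 hz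
    by_cases hp : ∀ i, 0 < z i
    · rw [indicator_of_mem]
      · simp only [homeomorphUnitSphereProd_apply_fst_coe,
          homeomorphUnitSphereProd_apply_snd_coe, PiLp.smul_apply, smul_eq_mul]
        rw [Real.rpow_sum_of_pos hz0, EuclideanSpace.norm_eq,
          Real.sq_sqrt (by positivity), ← Finset.sum_neg_distrib, Real.exp_sum, ← mul_assoc,
          ← Finset.prod_mul_distrib, ← Finset.prod_mul_distrib]
        refine Finset.prod_congr rfl fun i _ => ?_
        rw [hh]; simp only
        rw [indicator_of_mem (show z i ∈ Ioi (0:ℝ) from hp i), Real.norm_eq_abs, sq_abs,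
          ← EuclideanSpace.norm_eq]
        rw [← Real.mul_rpow (mul_nonneg (inv_nonneg.2 hz0.le) (hp i).le) hz0.le]
        congr 2
        field_simp
      · simp only [mem_preimage, spherePlus, mem_ofPred_eq, homeomorphUnitSphereProd_apply_fst_coe,
          PiLp.smul_apply, smul_eq_mul]
        intro i
        exact mul_pos (inv_pos.2 hz0) (hp i)
    · rw [indicator_of_notMem]
      · push Not at hp
        obtain ⟨i, hi⟩ := hp
        rw [zero_mul]
        refine Finset.prod_eq_zero (Finset.mem_univ i) ?_
        rw [hh]; simp only
        rw [indicator_of_notMem]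
        simpa using hi
      · simp only [mem_preimage, spherePlus, mem_ofPred_eq, homeomorphUnitSphereProd_apply_fst_coe,
          PiLp.smul_apply, smul_eq_mul]
        intro hq
        exact hp fun i => by
          have := hq i
          exact (mul_pos_iff_of_pos_left (inv_pos.2 hz0)).1 this
  rw [e2, integral_prod_mul (((Subtype.val ⁻¹' (spherePlus n)).indicator
          (fun θ => ∏ i, (θ.1 i) ^ δ i) : Metric.sphere (0 : EuclideanSpace ℝ (Fin n)) 1 → ℝ))
          (fun p : Ioi (0:ℝ) => (p.1 ^ (∑ i, δ i) * Real.exp (-p.1 ^ 2)))]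
  have hmeas : MeasurableSet (spherePlus n) := by
    have : spherePlus n = ⋂ i, {θ | 0 < θ i} := by ext; simp [spherePlus]
    rw [this]
    exact MeasurableSet.iInter fun i => measurableSet_lt measurable_const (by fun_prop)
  congr 1
  · rw [integral_indicator (measurable_subtype_coe hmeas), wArea, sphereMeasure,
      (MeasurableEmbedding.subtype_coe Metric.isClosed_sphere.measurableSet).setIntegral_map]
  · rw [Measure.volumeIoiPow, integral_withDensity_eq_integral_toReal_smul₀ (by fun_prop)
      (by simp)]
    have : ∀ r : Ioi (0:ℝ), (ENNReal.ofReal (r.1 ^ (Module.finrank ℝ (EuclideanSpace ℝ (Fin n)) - 1))).toReal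
       • (r.1 ^ (∑ i, δ i) * Real.exp (-r.1 ^ 2)) =
        (fun r : ℝ => r ^ ((n:ℝ) - 1 + ∑ i, δ i) * Real.exp (-r ^ 2)) r.1 := by
      rintro ⟨r, hr⟩
      simp only [mem_Ioi] at hr
      simp only [finrank_euclideanSpace, Fintype.card_fin, smul_eq_mul]
      rw [ENNReal.toReal_ofReal (by positivity), Real.rpow_add hr, ← Nat.cast_pred hn,
        Real.rpow_natCast, mul_assoc]
    simp_rw [this]
    rw [integral_subtype_comap measurableSet_Ioi
      (fun r : ℝ => r ^ ((n:ℝ) - 1 + ∑ i, δ i) * Real.exp (-r ^ 2)), h1]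
    · congr 3; ring
    · have : (0:ℝ) < n := by exact_mod_cast hn
      linarith

open Topology Asymptotics

lemma taylor2 {E : Type*} [NormedAddCommGroup E] [NormedSpace ℝ E] {g : E → ℝ} {a : E}
    (hg : ContDiffAt ℝ 2 g a) :
    (fun k => g (a + k) - g a - fderiv ℝ g a k - (1/2) * fderiv ℝ (fderiv ℝ g) a k k)
      =o[𝓝 0] fun k => ‖k‖ ^ 2 := by
  have hsym : IsSymmSndFDerivAt ℝ g a := hg.isSymmSndFDerivAt (by simp)
  have hd : DifferentiableAt ℝ (fderiv ℝ g) a :=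
    (hg.fderiv_right (m := 1) (by norm_num)).differentiableAt (by norm_num)
  set B := fderiv ℝ (fderiv ℝ g) a with hB
  have hlo := hasFDerivAt_iff_isLittleO_nhds_zero.1 hd.hasFDerivAt
  have hdiff : ∀ᶠ w in 𝓝 a, DifferentiableAt ℝ g w := by
    filter_upwards [hg.eventually (by simp)] with w hw
    exact hw.differentiableAt (by norm_num)
  have hdiff' : ∀ᶠ k in 𝓝 (0:E), DifferentiableAt ℝ g (a + k) := by
    have : Tendsto (fun k : E => a + k) (𝓝 0) (𝓝 a) := by
      have : Continuous (fun k : E => a + k) := by fun_prop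
      simpa using this.tendsto 0
    exact this.eventually hdiff
  rw [isLittleO_iff]
  intro ε hε
  have h1 := (isLittleO_iff.1 hlo) hε
  obtain ⟨δ, hδ, hball⟩ := Metric.eventually_nhds_iff_ball.1 (h1.and hdiff')
  refine Metric.eventually_nhds_iff_ball.2 ⟨δ, hδ, fun k hk => ?_⟩
  set ψ : E → ℝ := fun k => g (a + k) - g a - fderiv ℝ g a k - (1/2) * B k k with hψ
  have hk' : ‖k‖ < δ := by simpa using hk
  have hder : ∀ h ∈ Metric.closedBall (0:E) ‖k‖,
      HasFDerivWithinAt ψ (fderiv ℝ g (a + h) - fderiv ℝ g a - B h)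
        (Metric.closedBall (0:E) ‖k‖) h := by
    intro h hh
    have hh' : h ∈ Metric.ball (0:E) δ := by
      simp only [mem_closedBall_zero_iff, mem_ball_zero_iff] at *
      linarith
    have hd1 := (hball h hh').2
    have e1 : HasFDerivAt (fun k => g (a + k)) (fderiv ℝ g (a + h)) h := by
      have := hd1.hasFDerivAt.comp h ((hasFDerivAt_id h).const_add a)
      rw [ContinuousLinearMap.comp_id] at this
      exact this
    have e2 : HasFDerivAt (fun k => B k k) (B h + B.flip h) h := by
      have := B.hasFDerivAt.clm_apply (hasFDerivAt_id h)
      simpa using this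
    have e3 := ((e1.sub_const (g a)).sub (fderiv ℝ g a).hasFDerivAt).sub (e2.const_mul (1/2))
    refine (e3.congr_fderiv ?_).hasFDerivWithinAt
    ext v
    have := hsym.eq h v
    simp only [_root_.sub_apply, _root_.smul_apply,
      _root_.add_apply, ContinuousLinearMap.flip_apply, smul_eq_mul]
    rw [hB, this]; ring
  have := (convex_closedBall (0:E) ‖k‖).norm_image_sub_le_of_norm_hasFDerivWithin_le
    (C := ε * ‖k‖) hder (fun h hh => by
      have hh' : h ∈ Metric.ball (0:E) δ := by
        simp only [mem_closedBall_zero_iff, mem_ball_zero_iff] at *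
        linarith
      refine ((hball h hh').1).trans ?_
      gcongr
      simpa using hh) (x := 0) (y := k) (by simp) (by simp)
  have h0 : ψ 0 = 0 := by simp [hψ]
  rw [h0] at this
  simp only [sub_zero] at this
  calc _ ≤ _ := this
    _ = _ := by simp; ring

section dct
variable {Ω : Type*} [MeasurableSpace Ω] (μ : Measure Ω) [IsProbabilityMeasure μ] {n : ℕ}

lemma kbound {P Q : Fin n → ℝ} {M r : ℝ} (hP : ‖P‖ ≤ M) (hQ : ‖Q‖ ≤ M)
    (h0 : 0 < r) (h1 : r < 1) : ‖r ^ 2 • P + r • Q‖ ≤ 2 * M * r := by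
  have hM : 0 ≤ M := (norm_nonneg _).trans hP
  calc _ ≤ ‖r ^ 2 • P‖ + ‖r • Q‖ := norm_add_le _ _
    _ = r ^ 2 * ‖P‖ + r * ‖Q‖ := by
      rw [norm_smul, norm_smul, Real.norm_of_nonneg (by positivity), Real.norm_of_nonneg h0.le]
    _ ≤ r * M + r * M := by
      gcongr
      nlinarith
    _ = _ := by ring

/-- A property holding near `0` holds uniformly along small perturbations. -/
lemma unif_small {P Q : Ω → Fin n → ℝ} {M : ℝ}
    (hPM : ∀ᵐ ω ∂μ, ‖P ω‖ ≤ M) (hQM : ∀ᵐ ω ∂μ, ‖Q ω‖ ≤ M)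
    {p : (Fin n → ℝ) → Prop} (hp : ∀ᶠ k in 𝓝 0, p k) :
    ∀ᶠ r in 𝓝[>] (0:ℝ), ∀ᵐ ω ∂μ, p (r ^ 2 • P ω + r • Q ω) := by
  obtain ⟨δ, hδ, hball⟩ := Metric.eventually_nhds_iff_ball.1 hp
  have ht : Tendsto (fun r : ℝ => 2 * M * r) (𝓝[>] 0) (𝓝 0) := by
    have : Continuous (fun r : ℝ => 2 * M * r) := by fun_prop
    simpa using (this.tendsto 0).mono_left nhdsWithin_le_nhds
  filter_upwards [ht.eventually (gt_mem_nhds hδ), self_mem_nhdsWithin,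
    Ioo_mem_nhdsGT (show (0:ℝ) < 1 by norm_num)] with r hr h0 h1
  filter_upwards [hPM, hQM] with ω h2 h3
  refine hball _ ?_
  rw [mem_ball_zero_iff]
  exact (kbound h2 h3 h0 h1.2).trans_lt hr

lemma intble {g : (Fin n → ℝ) → ℝ} {a : Fin n → ℝ} (hg : ContDiffAt ℝ 2 g a)
    {P Q : Ω → Fin n → ℝ} (hP : Measurable P) (hQ : Measurable Q) {M : ℝ}
    (hPM : ∀ᵐ ω ∂μ, ‖P ω‖ ≤ M) (hQM : ∀ᵐ ω ∂μ, ‖Q ω‖ ≤ M) :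
    ∀ᶠ r in 𝓝[>] (0:ℝ), Integrable (fun ω => g (a + (r ^ 2 • P ω + r • Q ω))) μ := by
  have h1 : ∀ᶠ w in 𝓝 a, ContinuousAt g w := by
    filter_upwards [hg.eventually (by simp)] with w hw
    exact hw.continuousAt
  have h2 : ∀ᶠ w in 𝓝 a, ‖g w‖ < ‖g a‖ + 1 :=
    hg.continuousAt.norm.eventually (gt_mem_nhds (by linarith))
  obtain ⟨δ, hδ, hball⟩ := Metric.eventually_nhds_iff_ball.1 (h1.and h2)
  have hsm := unif_small μ hPM hQM (p := fun k => k ∈ Metric.ball 0 δ)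
    (Metric.ball_mem_nhds _ hδ)
  filter_upwards [hsm] with r hr
  classical
  set g' : (Fin n → ℝ) → ℝ := (Metric.ball a δ).piecewise g 0 with hg'
  have hm : Measurable g' := by
    refine ContinuousOn.measurable_piecewise ?_ continuousOn_const measurableSet_ball
    exact fun w hw => (hball w hw).1.continuousWithinAt
  have hmem : ∀ᵐ ω ∂μ, a + (r ^ 2 • P ω + r • Q ω) ∈ Metric.ball a δ := by
    filter_upwards [hr] with ω hω
    simpa using hω
  have hmm : Measurable (fun ω => g' (a + (r ^ 2 • P ω + r • Q ω))) :=
    hm.comp (by fun_prop)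
  refine Integrable.of_bound (C := ‖g a‖ + 1) ?_ ?_
  · refine ⟨_, hmm.stronglyMeasurable, ?_⟩
    filter_upwards [hmem] with ω hω
    rw [hg', Set.piecewise_eq_of_mem _ _ _ hω]
  · filter_upwards [hmem] with ω hω
    exact (hball _ hω).2.le

lemma asymp {g : (Fin n → ℝ) → ℝ} {a : Fin n → ℝ} (hg : ContDiffAt ℝ 2 g a)
    {P Q : Ω → Fin n → ℝ} (hP : Measurable P) (hQ : Measurable Q) {M : ℝ}
    (hPM : ∀ᵐ ω ∂μ, ‖P ω‖ ≤ M) (hQM : ∀ᵐ ω ∂μ, ‖Q ω‖ ≤ M) (hQ0 : ∫ ω, Q ω ∂μ = 0) :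
    Tendsto (fun r : ℝ => ((∫ ω, g (a + (r ^ 2 • P ω + r • Q ω)) ∂μ) - g a) / r ^ 2)
      (𝓝[>] 0) (𝓝 (∫ ω, (fderiv ℝ g a (P ω) +
        (1/2) * fderiv ℝ (fderiv ℝ g) a (Q ω) (Q ω)) ∂μ)) := by
  set D := fderiv ℝ g a with hD
  set B := fderiv ℝ (fderiv ℝ g) a with hB
  have hQi : Integrable Q μ := Integrable.of_bound hQ.aestronglyMeasurable M hQM
  have hPi : Integrable P μ := Integrable.of_bound hP.aestronglyMeasurable M hPM
  have hT := taylor2 hg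
  have hI := intble μ hg hP hQ hPM hQM
  have hM : 0 ≤ M := by
    obtain ⟨ω, hω⟩ := hPM.exists
    exact (norm_nonneg _).trans hω
  -- quadratic bound
  have hquad : ∀ᶠ k in 𝓝 (0 : Fin n → ℝ), ‖g (a + k) - g a - D k‖ ≤ (1 + ‖B‖) * ‖k‖ ^ 2 := by
    filter_upwards [(isLittleO_iff.1 hT) one_pos] with k hk
    have e : g (a + k) - g a - D k = (g (a + k) - g a - D k - 1 / 2 * B k k) + 1/2 * B k k := by
      ring
    rw [e]
    refine (norm_add_le _ _).trans ?_
    have h2 : ‖B k k‖ ≤ ‖B‖ * ‖k‖ * ‖k‖ := B.le_opNorm₂ k k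
    rw [norm_mul]
    have h3 : ‖(1/2 : ℝ)‖ ≤ 1 := by norm_num
    have h4 : ‖(1/2 : ℝ)‖ * ‖B k k‖ ≤ 1 * (‖B‖ * ‖k‖ * ‖k‖) := by gcongr
    rw [norm_pow, norm_norm] at hk
    linarith
  have hqu := unif_small μ hPM hQM hquad
  set F : ℝ → Ω → ℝ := fun r ω => (g (a + (r ^ 2 • P ω + r • Q ω)) - g a - r * D (Q ω)) / r ^ 2
    with hF
  have hDQ : Integrable (fun ω => D (Q ω)) μ := D.integrable_comp hQi
  have hDQ0 : ∫ ω, D (Q ω) ∂μ = 0 := by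
    rw [D.integral_comp_comm hQi, hQ0, map_zero]
  have hFint : ∀ᶠ r in 𝓝[>] (0:ℝ), ∫ ω, F r ω ∂μ =
      ((∫ ω, g (a + (r ^ 2 • P ω + r • Q ω)) ∂μ) - g a) / r ^ 2 := by
    filter_upwards [hI] with r hr
    rw [hF]; simp only
    have hr2 : Integrable (fun ω => g (a + (r ^ 2 • P ω + r • Q ω)) - g a) μ :=
      hr.sub (integrable_const _)
    rw [integral_div, integral_sub hr2 (hDQ.const_mul r),
      integral_sub hr (integrable_const _), integral_const_mul, hDQ0]
    simp
  refine Tendsto.congr' hFint ?_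
  refine tendsto_integral_filter_of_dominated_convergence
    (fun _ => ‖D‖ * M + (1 + ‖B‖) * (2 * M) ^ 2) ?_ ?_ (integrable_const _) ?_
  · filter_upwards [hI] with r hr
    exact (((hr.sub (integrable_const _)).sub (hDQ.const_mul r)).div_const _).aestronglyMeasurable
  · filter_upwards [hqu, self_mem_nhdsWithin, Ioo_mem_nhdsGT (show (0:ℝ) < 1 by norm_num)]
      with r hr h0 h1
    filter_upwards [hr, hPM, hQM] with ω h2 h3 h4
    have h0' : (0:ℝ) < r := h0
    have hk := kbound h3 h4 h0' h1.2
    rw [hF]; simp only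
    rw [norm_div, Real.norm_of_nonneg (sq_nonneg r), div_le_iff₀ (by positivity)]
    have e : g (a + (r ^ 2 • P ω + r • Q ω)) - g a - r * D (Q ω) =
      (g (a + (r ^ 2 • P ω + r • Q ω)) - g a - D (r ^ 2 • P ω + r • Q ω)) + r ^ 2 * D (P ω) := by
      simp only [map_add, map_smul, smul_eq_mul]; ring
    rw [e]
    calc _ ≤ _ := norm_add_le _ _
      _ ≤ (1 + ‖B‖) * (2 * M * r) ^ 2 + r ^ 2 * (‖D‖ * M) := by
        refine add_le_add (h2.trans (by gcongr)) ?_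
        rw [norm_mul, Real.norm_of_nonneg (sq_nonneg r)]
        gcongr
        exact (D.le_opNorm _).trans (by gcongr)
      _ = _ := by ring
  · filter_upwards [hPM, hQM] with ω h3 h4
    have hk0 : Tendsto (fun r : ℝ => r ^ 2 • P ω + r • Q ω) (𝓝[>] 0) (𝓝 0) := by
      have : Continuous (fun r : ℝ => r ^ 2 • P ω + r • Q ω) := by fun_prop
      simpa using (this.tendsto 0).mono_left nhdsWithin_le_nhds
    have hl := hT.comp_tendsto hk0
    have hO : (fun r : ℝ => ‖r ^ 2 • P ω + r • Q ω‖ ^ 2) =O[𝓝[>] 0] fun r : ℝ => r ^ 2 := by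
      refine IsBigO.of_bound ((2 * M) ^ 2) ?_
      filter_upwards [self_mem_nhdsWithin, Ioo_mem_nhdsGT (show (0:ℝ) < 1 by norm_num)] with r h0 h1
      rw [norm_pow, norm_norm, norm_pow, ← mul_pow, Real.norm_of_nonneg (le_of_lt h0)]
      gcongr
      exact kbound h3 h4 h0 h1.2
    have hl2 := (hl.trans_isBigO hO).tendsto_div_nhds_zero
    have hc : Tendsto (fun r : ℝ => D (P ω) + 1/2 * (r ^ 2 * B (P ω) (P ω) +
        r * (B (P ω) (Q ω) + B (Q ω) (P ω)) + B (Q ω) (Q ω))) (𝓝[>] 0)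
        (𝓝 (D (P ω) + 1/2 * B (Q ω) (Q ω))) := by
      have : Continuous (fun r : ℝ => D (P ω) + 1/2 * (r ^ 2 * B (P ω) (P ω) +
        r * (B (P ω) (Q ω) + B (Q ω) (P ω)) + B (Q ω) (Q ω))) := by fun_prop
      simpa using (this.tendsto 0).mono_left nhdsWithin_le_nhds
    have hs := hl2.add hc
    rw [zero_add] at hs
    refine hs.congr' ?_
    filter_upwards [self_mem_nhdsWithin] with r h0
    have h0' : r ≠ 0 := ne_of_gt h0
    simp only [hF, Function.comp, map_add, map_smul, smul_eq_mul, _root_.add_apply,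
      _root_.smul_apply]
    field_simp
    ring
end dct

lemma sin_rpow_meas (ν : ℝ) : Measurable (fun φ : ℝ => Real.sin φ ^ (ν - 1)) := by fun_prop

lemma transC_pos {ν : ℝ} (hν : 0 < ν) : 0 < transC ν := by
  have h1 : 0 < Real.Gamma ((ν + 1) / 2) := Real.Gamma_pos_of_pos (by linarith)
  have h2 : 0 < Real.Gamma (ν / 2) := Real.Gamma_pos_of_pos (by linarith)
  have h3 : 0 < Real.sqrt π := Real.sqrt_pos.2 Real.pi_pos
  unfold transC; positivity

lemma mom0 {ν : ℝ} (hν : 0 < ν) :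
    ∫ φ in Set.Icc (0:ℝ) π, transC ν * Real.sin φ ^ (ν - 1) = 1 := by
  have h1 : 0 < Real.Gamma ((ν + 1) / 2) := Real.Gamma_pos_of_pos (by linarith)
  have h2 : 0 < Real.Gamma (ν / 2) := Real.Gamma_pos_of_pos (by linarith)
  have h3 : 0 < Real.sqrt π := Real.sqrt_pos.2 Real.pi_pos
  rw [integral_const_mul, sin_int ν hν, transC]
  field_simp

lemma sin_intble {ν : ℝ} (hν : 0 < ν) :
    IntegrableOn (fun φ : ℝ => Real.sin φ ^ (ν - 1)) (Set.Icc (0:ℝ) π) := by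
  by_contra h
  have := mom0 hν
  rw [integral_const_mul, integral_undef h] at this
  simp at this

lemma mom1 (ν : ℝ) :
    ∫ φ in Set.Icc (0:ℝ) π, transC ν * Real.sin φ ^ (ν - 1) * Real.cos φ = 0 := by
  rw [integral_Icc_eq_integral_Ioc, ← intervalIntegral.integral_of_le Real.pi_pos.le]
  have := intervalIntegral.integral_comp_sub_left
    (fun φ => transC ν * Real.sin φ ^ (ν - 1) * Real.cos φ) (a := 0) (b := π) π
  simp only [Real.sin_pi_sub, Real.cos_pi_sub, sub_self, sub_zero, mul_neg,
    intervalIntegral.integral_neg] at this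
  linarith

lemma mom2 {ν : ℝ} (hν : 0 < ν) :
    ∫ φ in Set.Icc (0:ℝ) π, transC ν * Real.sin φ ^ (ν - 1) * (Real.cos φ * Real.cos φ)
      = 1 / (ν + 1) := by
  have h1 : 0 < Real.Gamma ((ν + 1) / 2) := Real.Gamma_pos_of_pos (by linarith)
  have h2 : 0 < Real.Gamma (ν / 2) := Real.Gamma_pos_of_pos (by linarith)
  have h3 : 0 < Real.sqrt π := Real.sqrt_pos.2 Real.pi_pos
  have e : ∫ φ in Set.Icc (0:ℝ) π, transC ν * Real.sin φ ^ (ν - 1) * (Real.cos φ * Real.cos φ)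
      = ∫ φ in Set.Icc (0:ℝ) π, (transC ν * Real.sin φ ^ (ν - 1)
        - transC ν * Real.sin φ ^ ((ν + 2) - 1)) := by
    rw [integral_Icc_eq_integral_Ioo, integral_Icc_eq_integral_Ioo]
    refine setIntegral_congr_fun measurableSet_Ioo fun φ hφ => ?_
    have hs : 0 < Real.sin φ := Real.sin_pos_of_pos_of_lt_pi hφ.1 hφ.2
    rw [show ν + 2 - 1 = (ν - 1) + 2 by ring, Real.rpow_add hs, Real.rpow_two]
    have := Real.sin_sq_add_cos_sq φ
    rw [show Real.cos φ * Real.cos φ = 1 - Real.sin φ ^ 2 by linarith [sq (Real.cos φ)]]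
    ring
  rw [e, integral_sub ((sin_intble hν).const_mul _)
    ((sin_intble (show 0 < ν + 2 by linarith)).const_mul _), mom0 hν, integral_const_mul,
    sin_int _ (show 0 < ν + 2 by linarith), transC,
    show (ν + 2) / 2 = ν / 2 + 1 by ring, show (ν + 2 + 1) / 2 = (ν + 1) / 2 + 1 by ring,
    Real.Gamma_add_one (by positivity), Real.Gamma_add_one (by positivity)]
  field_simp
  ring

/-- angular probability measure -/
def kap {n : ℕ} (γ : Fin n → ℝ) : Measure (Fin n → ℝ) :=
  (volume.restrict (Set.pi Set.univ (fun _ : Fin n => Set.Icc (0 : ℝ) π))).withDensity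
    (fun φ => ENNReal.ofReal (∏ i, (transC (γ i) * Real.sin (φ i) ^ (γ i - 1))))

lemma kap_integral {n : ℕ} {γ : Fin n → ℝ} (hγ : ∀ i, 0 < γ i) (h : (Fin n → ℝ) → ℝ) :
    ∫ φ, h φ ∂(kap γ) =
      ∫ φ in Set.pi Set.univ (fun _ : Fin n => Set.Icc (0 : ℝ) π),
        (∏ i, (transC (γ i) * Real.sin (φ i) ^ (γ i - 1))) * h φ := by
  rw [kap, integral_withDensity_eq_integral_toReal_smul₀]
  · refine setIntegral_congr_fun (MeasurableSet.univ_pi fun _ => measurableSet_Icc) ?_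
    intro φ hφ
    simp only [smul_eq_mul]
    rw [ENNReal.toReal_ofReal]
    refine Finset.prod_nonneg fun i _ => mul_nonneg (transC_pos (hγ i)).le ?_
    have := hφ i (mem_univ i)
    exact Real.rpow_nonneg (Real.sin_nonneg_of_nonneg_of_le_pi this.1 this.2) _
  · refine (Measurable.ennreal_ofReal ?_).aemeasurable
    fun_prop
  · simp

lemma kap_prod {n : ℕ} {γ : Fin n → ℝ} (hγ : ∀ i, 0 < γ i) (q : Fin n → ℝ → ℝ) :
    ∫ φ, (∏ i, q i (φ i)) ∂(kap γ) =
      ∏ i, ∫ t in Set.Icc (0:ℝ) π, transC (γ i) * Real.sin t ^ (γ i - 1) * q i t := by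
  rw [kap_integral hγ, volume_pi, Measure.restrict_pi_pi]
  simp_rw [← Finset.prod_mul_distrib]
  exact integral_fintype_prod_eq_prod
    (fun i t => transC (γ i) * Real.sin t ^ (γ i - 1) * q i t)

lemma kap_prob {n : ℕ} {γ : Fin n → ℝ} (hγ : ∀ i, 0 < γ i) : IsProbabilityMeasure (kap γ) := by
  have := kap_prod hγ (fun _ _ => 1)
  simp only [Finset.prod_const_one, mul_one, mom0 (hγ _), integral_const, smul_eq_mul] at this
  refine ⟨?_⟩
  rw [Measure.real, ENNReal.toReal_eq_one_iff] at this
  exact this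

lemma kap_cos {n : ℕ} {γ : Fin n → ℝ} (hγ : ∀ i, 0 < γ i) (i : Fin n) :
    ∫ φ, Real.cos (φ i) ∂(kap γ) = 0 := by
  classical
  have := kap_prod hγ (fun k t => if k = i then Real.cos t else 1)
  simp only [Finset.prod_ite_eq', Finset.mem_univ, if_true] at this
  rw [this]
  refine Finset.prod_eq_zero (Finset.mem_univ i) ?_
  simpa using mom1 (γ i)

lemma kap_cos_cos {n : ℕ} {γ : Fin n → ℝ} (hγ : ∀ i, 0 < γ i) (i j : Fin n) :
    ∫ φ, Real.cos (φ i) * Real.cos (φ j) ∂(kap γ) = if i = j then 1 / (γ i + 1) else 0 := by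
  classical
  have := kap_prod hγ (fun k t => (if k = i then Real.cos t else 1) *
    (if k = j then Real.cos t else 1))
  simp only [Finset.prod_mul_distrib, Finset.prod_ite_eq', Finset.mem_univ, if_true] at this
  rw [this]
  split_ifs with h
  · subst h
    rw [Finset.prod_eq_single i]
    · simpa using mom2 (hγ i)
    · intro k _ hk
      simpa [hk] using mom0 (hγ k)
    · simp
  · refine Finset.prod_eq_zero (Finset.mem_univ i) ?_
    simpa [h] using mom1 (γ i)

lemma spherePlus_meas (n : ℕ) : MeasurableSet (spherePlus n) := by
  have : spherePlus n = ⋂ i, {θ | 0 < θ i} := by ext; simp [spherePlus]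
  rw [this]
  exact MeasurableSet.iInter fun i => measurableSet_lt measurable_const (by fun_prop)

lemma wArea_pos {n : ℕ} (hn : 0 < n) {γ : Fin n → ℝ} (hγ : ∀ i, 0 < γ i) : 0 < wArea n γ := by
  have h := wArea_formula n hn γ hγ
  have h0 : 0 ≤ ∑ i, γ i := Finset.sum_nonneg fun i _ => (hγ i).le
  have hn' : (0:ℝ) < n := by exact_mod_cast hn
  have h1 : 0 < ∏ i, (Real.Gamma ((γ i + 1) / 2) / 2) := Finset.prod_pos fun i _ => by
    have := Real.Gamma_pos_of_pos (show 0 < (γ i + 1) / 2 by linarith [hγ i])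
    positivity
  have h2 : 0 < Real.Gamma (((n:ℝ) + ∑ i, γ i) / 2) / 2 := by
    have := Real.Gamma_pos_of_pos (show 0 < ((n:ℝ) + ∑ i, γ i) / 2 by linarith)
    positivity
  rw [← h] at h1
  exact pos_of_mul_pos_left h1 h2.le

/-- weighted sphere probability measure -/
def sph {n : ℕ} (γ : Fin n → ℝ) : Measure (EuclideanSpace ℝ (Fin n)) :=
  ((sphereMeasure n).restrict (spherePlus n)).withDensity
    (fun θ => ENNReal.ofReal ((wArea n γ)⁻¹ * ∏ i, θ i ^ γ i))

lemma sph_integral {n : ℕ} (hn : 0 < n) {γ : Fin n → ℝ} (hγ : ∀ i, 0 < γ i)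
    (h : EuclideanSpace ℝ (Fin n) → ℝ) :
    ∫ θ, h θ ∂(sph γ) =
      (wArea n γ)⁻¹ * ∫ θ in spherePlus n, h θ * ∏ i, θ i ^ γ i ∂(sphereMeasure n) := by
  rw [sph, integral_withDensity_eq_integral_toReal_smul₀, ← integral_const_mul]
  · refine setIntegral_congr_fun (spherePlus_meas n) ?_
    intro θ hθ
    simp only [smul_eq_mul]
    rw [ENNReal.toReal_ofReal]
    · ring
    · exact mul_nonneg (inv_nonneg.2 (wArea_pos hn hγ).le)
        (Finset.prod_nonneg fun i _ => Real.rpow_nonneg (hθ i).le _)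
  · refine (Measurable.ennreal_ofReal ?_).aemeasurable
    fun_prop
  · simp

lemma sph_prob {n : ℕ} (hn : 0 < n) {γ : Fin n → ℝ} (hγ : ∀ i, 0 < γ i) :
    IsProbabilityMeasure (sph γ) := by
  have := sph_integral hn hγ (fun _ => 1)
  have hw := wArea_pos hn hγ
  simp only [one_mul, integral_const, smul_eq_mul, mul_one] at this
  rw [← wArea, inv_mul_cancel₀ hw.ne'] at this
  refine ⟨?_⟩
  rw [Measure.real, ENNReal.toReal_eq_one_iff] at this
  exact this

lemma sph_sq {n : ℕ} (hn : 0 < n) {γ : Fin n → ℝ} (hγ : ∀ i, 0 < γ i) (i : Fin n) :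
    ∫ θ, θ i ^ 2 ∂(sph γ) = (γ i + 1) / ((n:ℝ) + ∑ i, γ i) := by
  classical
  set δ : Fin n → ℝ := fun k => γ k + if k = i then 2 else 0 with hδ
  have hδp : ∀ k, 0 < δ k := fun k => by
    have := hγ k
    simp only [hδ]; split_ifs <;> linarith
  have hsum : ∑ k, δ k = ∑ k, γ k + 2 := by
    simp [hδ, Finset.sum_add_distrib]
  have h0 : 0 ≤ ∑ i, γ i := Finset.sum_nonneg fun i _ => (hγ i).le
  have hn' : (0:ℝ) < n := by exact_mod_cast hn
  have f1 := wArea_formula n hn γ hγ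
  have f2 := wArea_formula n hn δ hδp
  have hwp := wArea_pos hn hγ
  rw [sph_integral hn hγ]
  have e : ∫ θ in spherePlus n, θ i ^ 2 * ∏ i, θ i ^ γ i ∂(sphereMeasure n) = wArea n δ := by
    rw [wArea]
    refine setIntegral_congr_fun (spherePlus_meas n) ?_
    intro θ hθ
    simp only [hδ]
    have : ∀ k, θ k ^ (γ k + if k = i then (2:ℝ) else 0) =
        (if k = i then θ k ^ 2 else 1) * θ k ^ γ k := by
      intro k
      rw [Real.rpow_add (hθ k)]
      split_ifs <;> simp [mul_comm]
    simp_rw [this]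
    rw [Finset.prod_mul_distrib]
    simp
  rw [e]
  have hprod : ∏ k, (Real.Gamma ((δ k + 1) / 2) / 2) =
      ((γ i + 1) / 2) * ∏ k, (Real.Gamma ((γ k + 1) / 2) / 2) := by
    have : ∀ k, Real.Gamma ((δ k + 1) / 2) / 2 =
        (if k = i then (γ k + 1) / 2 else 1) * (Real.Gamma ((γ k + 1) / 2) / 2) := by
      intro k
      simp only [hδ]
      split_ifs
      · rw [show (γ k + 2 + 1) / 2 = (γ k + 1) / 2 + 1 by ring,
          Real.Gamma_add_one (by have := hγ k; positivity)]
        ring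
      · simp
    simp_rw [this]
    rw [Finset.prod_mul_distrib]
    simp
  rw [hprod, ← f1, hsum, show ((n:ℝ) + (∑ k, γ k + 2)) / 2 = ((n:ℝ) + ∑ k, γ k) / 2 + 1 by ring,
    Real.Gamma_add_one (by positivity)] at f2
  have hG := Real.Gamma_pos_of_pos (show 0 < ((n:ℝ) + ∑ i, γ i) / 2 by linarith)
  have hN : 0 < (n:ℝ) + ∑ i, γ i := by linarith
  set G := Real.Gamma (((n:ℝ) + ∑ i, γ i) / 2)
  have f3 : wArea n δ * ((n:ℝ) + ∑ i, γ i) = (γ i + 1) * wArea n γ := by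
    have : G * (wArea n δ * ((n:ℝ) + ∑ i, γ i)) = G * ((γ i + 1) * wArea n γ) := by linarith
    exact mul_left_cancel₀ hG.ne' this
  field_simp
  linarith

lemma sph_norm {n : ℕ} (γ : Fin n → ℝ) : ∀ᵐ θ ∂(sph γ), ∀ i, |θ i| ≤ 1 := by
  have h1 : ∀ᵐ θ ∂(sphereMeasure n), ∀ i, |θ i| ≤ 1 := by
    rw [sphereMeasure, (MeasurableEmbedding.subtype_coe
      Metric.isClosed_sphere.measurableSet).ae_map_iff]
    refine Eventually.of_forall ?_
    rintro ⟨θ, hθ⟩ i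
    have : ‖θ i‖ ≤ ‖θ‖ := PiLp.norm_apply_le θ i
    rw [Real.norm_eq_abs] at this
    simpa [mem_sphere_zero_iff_norm.1 hθ] using this
  exact (withDensity_absolutelyContinuous _ _).ae_le (ae_restrict_of_ae h1)

/-- `f` in the squared variables. -/
def sqv {n : ℕ} (f : (Fin n → ℝ) → ℝ) (w : Fin n → ℝ) : ℝ := f (fun i => Real.sqrt (w i))

lemma sqv_contDiffAt {n : ℕ} {f : (Fin n → ℝ) → ℝ} {x : Fin n → ℝ} (hx : ∀ i, 0 < x i)
    (hf : ContDiffAt ℝ 2 f x) : ContDiffAt ℝ 2 (sqv f) (fun i => x i ^ 2) := by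
  have e : (fun i => Real.sqrt ((fun i => x i ^ 2) i)) = x := by
    funext i; exact Real.sqrt_sq (hx i).le
  refine ContDiffAt.comp (g := f) (f := fun w : Fin n → ℝ => fun i => Real.sqrt (w i)) _ ?_ ?_
  · simp only at e ⊢
    rw [e]; exact hf
  · rw [contDiffAt_pi]
    intro i
    exact ContDiffAt.sqrt (contDiff_apply ℝ ℝ i).contDiffAt (by have := hx i; positivity)

lemma fderiv_line {n : ℕ} {G : (Fin n → ℝ) → (Fin n → ℝ) →L[ℝ] ℝ}
    {B : (Fin n → ℝ) →L[ℝ] (Fin n → ℝ) →L[ℝ] ℝ} {l : ℝ → Fin n → ℝ} {l' : Fin n → ℝ} {s : ℝ}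
    (hG : HasFDerivAt G B (l s)) (hl : HasDerivAt l l' s) (v : Fin n → ℝ) :
    HasDerivAt (fun t => G (l t) v) (B l' v) s := by
  have h1 : HasDerivAt (fun t => G (l t)) (B l') s := hG.comp_hasDerivAt s hl
  have h2 := ((ContinuousLinearMap.apply ℝ ℝ v).hasFDerivAt (x := G (l s))).comp_hasDerivAt s h1
  exact h2

lemma lin_expand {n : ℕ} (D : (Fin n → ℝ) →L[ℝ] ℝ) (v : Fin n → ℝ) :
    D v = ∑ i, v i * D (Pi.single i 1) := by
  conv_lhs => rw [pi_eq_sum_univ' v, map_sum]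
  exact Finset.sum_congr rfl fun i _ => by rw [map_smul, smul_eq_mul]

lemma bil_expand {n : ℕ} (B : (Fin n → ℝ) →L[ℝ] (Fin n → ℝ) →L[ℝ] ℝ) (v : Fin n → ℝ) :
    B v v = ∑ i, ∑ j, v i * v j * B (Pi.single i 1) (Pi.single j 1) := by
  have h := lin_expand (B.flip v) v
  simp only [ContinuousLinearMap.flip_apply] at h
  rw [h]
  refine Finset.sum_congr rfl fun i _ => ?_
  rw [lin_expand (B (Pi.single i 1)) v, Finset.mul_sum]
  exact Finset.sum_congr rfl fun j _ => by ring

lemma lap_eq {n : ℕ} (γ : Fin n → ℝ) {f : (Fin n → ℝ) → ℝ} {x : Fin n → ℝ} (hx : ∀ i, 0 < x i)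
    (hf : ContDiffAt ℝ 2 f x) :
    laplaceBessel γ f x = ∑ i, (2 * (1 + γ i) *
        fderiv ℝ (sqv f) (fun i => x i ^ 2) (Pi.single i 1) +
      4 * x i ^ 2 * fderiv ℝ (fderiv ℝ (sqv f)) (fun i => x i ^ 2) (Pi.single i 1)
        (Pi.single i 1)) := by
  have hg := sqv_contDiffAt hx hf
  set a : Fin n → ℝ := fun i => x i ^ 2 with ha
  set g := sqv f with hgd
  refine Finset.sum_congr rfl fun i _ => ?_
  have hup : ∀ t : ℝ, 0 < t → f (Function.update x i t) = g (Function.update a i (t ^ 2)) := by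
    intro t ht
    rw [hgd, sqv]
    congr 1
    funext k
    by_cases hk : k = i
    · subst hk; simp [Real.sqrt_sq ht.le]
    · simp [hk, ha, Real.sqrt_sq (hx k).le]
  have hcont : Continuous (fun s : ℝ => Function.update a i (s ^ 2)) :=
    continuous_const.update i (by fun_prop)
  have hai : Function.update a i (x i ^ 2) = a := by simp [ha]
  have hdiff : ∀ᶠ s in 𝓝 (x i), DifferentiableAt ℝ g (Function.update a i (s ^ 2)) := by
    have h1 : ∀ᶠ w in 𝓝 a, DifferentiableAt ℝ g w := by
      filter_upwards [hg.eventually (by simp)] with w hw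
      exact hw.differentiableAt (by norm_num)
    have h2 := hcont.tendsto (x i)
    simp only [hai] at h2
    exact h2.eventually h1
  have hline : ∀ s : ℝ, HasDerivAt (fun t : ℝ => Function.update a i (t ^ 2))
      ((2 * s) • (Pi.single i (1:ℝ) : Fin n → ℝ)) s := by
    intro s
    have h1 : HasDerivAt (fun t : ℝ => t ^ 2) (2 * s) s := by simpa using hasDerivAt_pow 2 s
    exact (hasDerivAt_update a i (s ^ 2)).scomp s h1
  have hp1 : ∀ᶠ s in 𝓝 (x i), pderiv' i f (Function.update x i s) =
      2 * s * fderiv ℝ g (Function.update a i (s ^ 2)) (Pi.single i 1) := by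
    filter_upwards [hdiff, lt_mem_nhds (hx i)] with s hs hs0
    rw [pderiv']
    simp only [Function.update_idem, Function.update_self]
    have h1 := hs.hasFDerivAt.comp_hasDerivAt s (hline s)
    have h2 : (fun t => f (Function.update x i t)) =ᶠ[𝓝 s]
        g ∘ (fun t => Function.update a i (t ^ 2)) := by
      filter_upwards [lt_mem_nhds hs0] with t ht
      exact hup t ht
    rw [h2.deriv_eq, h1.deriv]
    simp
  have hfx : pderiv' i f x = 2 * x i * fderiv ℝ g a (Pi.single i 1) := by
    have := hp1.self_of_nhds
    rwa [hai, Function.update_eq_self] at this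
  have hd : DifferentiableAt ℝ (fderiv ℝ g) a :=
    (hg.fderiv_right (m := 1) (by norm_num)).differentiableAt (by norm_num)
  have hd2 : HasDerivAt (fun s => 2 * s * fderiv ℝ g (Function.update a i (s ^ 2)) (Pi.single i 1))
      (2 * fderiv ℝ g a (Pi.single i 1) +
        2 * x i * (2 * x i * fderiv ℝ (fderiv ℝ g) a (Pi.single i 1) (Pi.single i 1))) (x i) := by
    have hd' : HasFDerivAt (fderiv ℝ g) (fderiv ℝ (fderiv ℝ g) a)
        (Function.update a i (x i ^ 2)) := by rw [hai]; exact hd.hasFDerivAt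
    have h1 := fderiv_line (l := fun t : ℝ => Function.update a i (t ^ 2)) hd' (hline (x i)) (Pi.single i (1:ℝ))
    have h2 : HasDerivAt (fun s : ℝ => 2 * s) 2 (x i) := by
      simpa using (hasDerivAt_id (x i)).const_mul 2
    have h3 := h2.mul h1
    refine h3.congr_deriv ?_
    simp only [hai, map_smul, _root_.smul_apply, smul_eq_mul]
  have hfxx : pderiv' i (pderiv' i f) x = 2 * fderiv ℝ g a (Pi.single i 1) +
        2 * x i * (2 * x i * fderiv ℝ (fderiv ℝ g) a (Pi.single i 1) (Pi.single i 1)) := by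
    rw [pderiv']
    rw [Filter.EventuallyEq.deriv_eq hp1, hd2.deriv]
  rw [hfx, hfxx]
  have := (hx i).ne'
  field_simp
  ring

lemma mean_asymp {n : ℕ} (hn : 0 < n) {γ : Fin n → ℝ} (hγ : ∀ i, 0 < γ i)
    {f : (Fin n → ℝ) → ℝ} {x : Fin n → ℝ} (hx : ∀ i, 0 < x i) (hf : ContDiffAt ℝ 2 f x) :
    Tendsto (fun r : ℝ => (wMean γ f x r - f x) / r ^ 2) (𝓝[>] 0)
      (𝓝 (laplaceBessel γ f x / (2 * ((n:ℝ) + ∑ i, γ i)))) := by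
  have hg := sqv_contDiffAt hx hf
  have hlap := lap_eq γ hx hf
  set a : Fin n → ℝ := fun i => x i ^ 2 with ha
  have hga : sqv f a = f x := by
    rw [sqv]; congr 1; funext i; exact Real.sqrt_sq (hx i).le
  have hN : 0 < (n:ℝ) + ∑ i, γ i := by
    have h0 : 0 ≤ ∑ i, γ i := Finset.sum_nonneg fun i _ => (hγ i).le
    have hn' : (0:ℝ) < n := by exact_mod_cast hn
    linarith
  have := kap_prob hγ
  have := sph_prob hn hγ
  set μ := (sph γ).prod (kap γ) with hμ
  set P : EuclideanSpace ℝ (Fin n) × (Fin n → ℝ) → Fin n → ℝ := fun ω i => ω.1 i ^ 2 with hP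
  set Q : EuclideanSpace ℝ (Fin n) × (Fin n → ℝ) → Fin n → ℝ :=
    fun ω i => -2 * x i * (ω.1 i * Real.cos (ω.2 i)) with hQ
  have hPm : Measurable P := by rw [hP]; fun_prop
  have hQm : Measurable Q := by rw [hQ]; fun_prop
  have hae : ∀ᵐ ω ∂μ, ∀ i, |ω.1 i| ≤ 1 :=
    Measure.quasiMeasurePreserving_fst.ae (sph_norm γ)
  have hPM : ∀ᵐ ω ∂μ, ‖P ω‖ ≤ 1 + 2 * ‖x‖ := by
    filter_upwards [hae] with ω hω
    refine (pi_norm_le_iff_of_nonneg (by positivity)).2 fun i => ?_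
    simp only [hP, norm_pow, Real.norm_eq_abs]
    have h1 : |ω.1 i| ^ 2 ≤ 1 := pow_le_one₀ (abs_nonneg _) (hω i)
    have := norm_nonneg x
    linarith
  have hQM : ∀ᵐ ω ∂μ, ‖Q ω‖ ≤ 1 + 2 * ‖x‖ := by
    filter_upwards [hae] with ω hω
    refine (pi_norm_le_iff_of_nonneg (by positivity)).2 fun i => ?_
    simp only [hQ, norm_mul]
    have h1 : ‖ω.1 i‖ * ‖Real.cos (ω.2 i)‖ ≤ 1 :=
      mul_le_one₀ (hω i) (norm_nonneg _) (Real.abs_cos_le_one _)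
    have h2 : ‖x i‖ ≤ ‖x‖ := norm_le_pi_norm x i
    have h3 : ‖(-2:ℝ)‖ = 2 := by norm_num
    rw [h3]
    calc 2 * ‖x i‖ * (‖ω.1 i‖ * ‖Real.cos (ω.2 i)‖) ≤ 2 * ‖x‖ * 1 := by gcongr
      _ ≤ _ := by linarith
  have hQi : Integrable Q μ := Integrable.of_bound hQm.aestronglyMeasurable _ hQM
  have hPi : Integrable P μ := Integrable.of_bound hPm.aestronglyMeasurable _ hPM
  have hQ0 : ∫ ω, Q ω ∂μ = 0 := by
    funext i
    rw [eval_integral (fun j => hQi.eval j)]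
    simp only [hQ, Pi.zero_apply]
    rw [integral_const_mul, hμ, integral_prod_mul (fun θ : EuclideanSpace ℝ (Fin n) => θ i)
      (fun φ : Fin n → ℝ => Real.cos (φ i)), kap_cos hγ]
    simp
  have hP1 : ∀ i, ∫ ω, P ω i ∂μ = (γ i + 1) / ((n:ℝ) + ∑ i, γ i) := by
    intro i
    have h1 := integral_prod_mul (μ := sph γ) (ν := kap γ)
      (fun θ : EuclideanSpace ℝ (Fin n) => θ i ^ 2) (fun _ : Fin n → ℝ => (1:ℝ))
    simp only [mul_one, integral_const, probReal_univ, smul_eq_mul] at h1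
    rw [hμ, hP, h1, sph_sq hn hγ]
  have hQQ : ∀ i j, ∫ ω, Q ω i * Q ω j ∂μ =
      if i = j then 4 * x i ^ 2 / ((n:ℝ) + ∑ i, γ i) else 0 := by
    intro i j
    have h1 : ∀ ω : EuclideanSpace ℝ (Fin n) × (Fin n → ℝ), Q ω i * Q ω j =
        (4 * x i * x j) * ((ω.1 i * ω.1 j) * (Real.cos (ω.2 i) * Real.cos (ω.2 j))) := by
      intro ω; simp only [hQ]; ring
    simp_rw [h1]
    rw [integral_const_mul, hμ, integral_prod_mul
      (fun θ : EuclideanSpace ℝ (Fin n) => θ i * θ j)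
      (fun φ : Fin n → ℝ => Real.cos (φ i) * Real.cos (φ j)), kap_cos_cos hγ]
    split_ifs with h
    · subst h
      have h2 := sph_sq hn hγ i
      simp only [sq] at h2
      rw [h2]
      have : 0 < γ i + 1 := by linarith [hγ i]
      field_simp
    · simp
  have hmain := asymp μ hg hPm hQm hPM hQM hQ0
  have hI := intble μ hg hPm hQm hPM hQM
  set D := fderiv ℝ (sqv f) a with hD
  set B := fderiv ℝ (fderiv ℝ (sqv f)) a with hB
  have hval : ∫ ω, (D (P ω) + (1/2) * B (Q ω) (Q ω)) ∂μ =
      laplaceBessel γ f x / (2 * ((n:ℝ) + ∑ i, γ i)) := by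
    have hQQi : ∀ i j, Integrable (fun ω => Q ω i * Q ω j) μ := by
      intro i j
      refine Integrable.of_bound (by fun_prop) ((1 + 2 * ‖x‖) * (1 + 2 * ‖x‖)) ?_
      filter_upwards [hQM] with ω hω
      rw [norm_mul]
      have h1 := (norm_le_pi_norm (Q ω) i).trans hω
      have h2 := (norm_le_pi_norm (Q ω) j).trans hω
      gcongr
    have hex : ∀ ω, D (P ω) + (1/2) * B (Q ω) (Q ω) = (∑ i, P ω i * D (Pi.single i 1)) +
        (1/2) * ∑ i, ∑ j, Q ω i * Q ω j * B (Pi.single i 1) (Pi.single j 1) := fun ω => by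
      rw [← lin_expand D (P ω), ← bil_expand B (Q ω)]
    rw [integral_congr_ae (Eventually.of_forall hex)]
    rw [integral_add, integral_const_mul, integral_finsetSum, integral_finsetSum]
    · simp_rw [integral_mul_const, hP1]
      rw [hlap, Finset.sum_div, Finset.mul_sum, ← Finset.sum_add_distrib]
      refine Finset.sum_congr rfl fun i _ => ?_
      rw [integral_finsetSum]
      · simp_rw [integral_mul_const, hQQ, ite_mul, zero_mul]
        rw [Finset.sum_ite_eq]
        simp only [Finset.mem_univ, if_true]
        field_simp
        ring
      · exact fun j _ => (hQQi i j).mul_const _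
    · exact fun i _ => integrable_finsetSum _ fun j _ => (hQQi i j).mul_const _
    · exact fun i _ => (hPi.eval i).mul_const _
    · exact integrable_finsetSum _ fun i _ => (hPi.eval i).mul_const _
    · exact (integrable_finsetSum _ fun i _ =>
        integrable_finsetSum _ fun j _ => (hQQi i j).mul_const _).const_mul _
  rw [hval, hga] at hmain
  refine hmain.congr' ?_
  filter_upwards [hI] with r hr
  congr 2
  rw [hμ, integral_prod _ hr, sph_integral hn hγ, wMean]
  congr 2
  funext θ
  congr 1
  rw [kap_integral hγ, gT, ← integral_const_mul]
  congr 1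
  funext φ
  rw [Finset.prod_mul_distrib, sqv]
  have : (fun i => Real.sqrt ((a + (r ^ 2 • P (θ, φ) + r • Q (θ, φ))) i)) =
    fun i => Real.sqrt (x i ^ 2 + (r * θ i) ^ 2 - 2 * x i * (r * θ i) * Real.cos (φ i)) := by
    funext i
    congr 1
    simp only [ha, hP, hQ, Pi.add_apply, Pi.smul_apply, smul_eq_mul]
    ring
  rw [this]
  ring

end Aux

/-- Converse Asgeirsson theorem for the B-ultrahyperbolic equation.
If `u ∈ C²(ℝ^{m'}_+ × ℝ^{m''}_+)` is even in each of its variables, `m' + |γ'| = m'' + |γ''|`,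
and the partial weighted spherical means agree, `M^{γ'}_u(x,r;y) = M^{γ''}_u(x;y,r)`, for all
`(x,y) ∈ ℝ^{m'}_+ × ℝ^{m''}_+` and all `r ≥ 0`, then `u` satisfies the B-ultrahyperbolic
equation `(Δ_{γ'})_x u = (Δ_{γ''})_y u` on `ℝ^{m'}_+ × ℝ^{m''}_+`. -/
theorem converse_asgeirsson_B_ultrahyperbolic
    (m' m'' : ℕ) (γ' : Fin m' → ℝ) (γ'' : Fin m'' → ℝ)
    (hγ' : ∀ i, 0 < γ' i) (hγ'' : ∀ j, 0 < γ'' j)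
    (hdim : (m' : ℝ) + ∑ i, γ' i = (m'' : ℝ) + ∑ j, γ'' j)
    (u : (Fin m' → ℝ) → (Fin m'' → ℝ) → ℝ)
    (hu : ContDiffOn ℝ 2 (fun p : (Fin m' → ℝ) × (Fin m'' → ℝ) => u p.1 p.2)
      {p | (∀ i, 0 < p.1 i) ∧ (∀ j, 0 < p.2 j)})
    (hevenx : ∀ (i : Fin m') (x : Fin m' → ℝ) (y : Fin m'' → ℝ),
      u (Function.update x i (-(x i))) y = u x y)
    (heveny : ∀ (j : Fin m'') (x : Fin m' → ℝ) (y : Fin m'' → ℝ),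
      u x (Function.update y j (-(y j))) = u x y)
    (hmeans : ∀ (x : Fin m' → ℝ) (y : Fin m'' → ℝ), (∀ i, 0 < x i) → (∀ j, 0 < y j) →
      ∀ r : ℝ, 0 ≤ r → wMean γ' (fun x' => u x' y) x r = wMean γ'' (fun y' => u x y') y r) :
    ∀ (x : Fin m' → ℝ) (y : Fin m'' → ℝ), (∀ i, 0 < x i) → (∀ j, 0 < y j) →
      laplaceBessel γ' (fun x' => u x' y) x = laplaceBessel γ'' (fun y' => u x y') y := by
  intro x y hx hy
  have hopen : IsOpen {p : (Fin m' → ℝ) × (Fin m'' → ℝ) | (∀ i, 0 < p.1 i) ∧ (∀ j, 0 < p.2 j)} := by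
    have h1 : IsOpen {p : (Fin m' → ℝ) × (Fin m'' → ℝ) | ∀ i, 0 < p.1 i} := by
      simp only [Set.setOf_forall]
      exact isOpen_iInter_of_finite fun i => isOpen_lt continuous_const (by fun_prop)
    have h2 : IsOpen {p : (Fin m' → ℝ) × (Fin m'' → ℝ) | ∀ j, 0 < p.2 j} := by
      simp only [Set.setOf_forall]
      exact isOpen_iInter_of_finite fun i => isOpen_lt continuous_const (by fun_prop)
    exact h1.inter h2
  have hat : ContDiffAt ℝ 2 (fun p : (Fin m' → ℝ) × (Fin m'' → ℝ) => u p.1 p.2) (x, y) :=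
    hu.contDiffAt (hopen.mem_nhds ⟨hx, hy⟩)
  have hfx : ContDiffAt ℝ 2 (fun x' => u x' y) x :=
    ContDiffAt.comp (g := fun p : (Fin m' → ℝ) × (Fin m'' → ℝ) => u p.1 p.2)
      (f := fun x' => (x', y)) x hat (contDiffAt_id.prodMk contDiffAt_const)
  have hfy : ContDiffAt ℝ 2 (fun y' => u x y') y :=
    ContDiffAt.comp (g := fun p : (Fin m' → ℝ) × (Fin m'' → ℝ) => u p.1 p.2)
      (f := fun y' => (x, y')) y hat (contDiffAt_const.prodMk contDiffAt_id)
  have hs' : 0 ≤ ∑ i, γ' i := Finset.sum_nonneg fun i _ => (hγ' i).le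
  have hs'' : 0 ≤ ∑ i, γ'' i := Finset.sum_nonneg fun i _ => (hγ'' i).le
  rcases Nat.eq_zero_or_pos m' with h0 | hp'
  · subst h0
    have hm : (m'' : ℝ) = 0 := by
      have : (0:ℝ) ≤ m'' := Nat.cast_nonneg _
      simp at hdim
      linarith
    have hm2 : m'' = 0 := by exact_mod_cast hm
    subst hm2
    simp [laplaceBessel]
  · rcases Nat.eq_zero_or_pos m'' with h0 | hp''
    · subst h0
      have : (0:ℝ) < m' := by exact_mod_cast hp'
      simp at hdim
      linarith
    · have t1 := mean_asymp hp' hγ' hx hfx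
      have t2 := mean_asymp hp'' hγ'' hy hfy
      have t3 := t1.congr' (f₂ := fun r : ℝ =>
          (wMean γ'' (fun y' => u x y') y r - u x y) / r ^ 2) (by
        filter_upwards [self_mem_nhdsWithin] with r hr
        rw [hmeans x y hx hy r (le_of_lt hr)])
      have h := tendsto_nhds_unique t3 t2
      have hN : 0 < (m'' : ℝ) + ∑ j, γ'' j := by
        have : (0:ℝ) < m'' := by exact_mod_cast hp''
        linarith
      rw [hdim] at h
      exact (div_left_inj' (by positivity)).1 h
end
end

section
/- (Classical Asgeirsson mean-value theorem.) Let u = u(x,y) ∈ C²(ℝ^n × ℝ^n) be a solution of the ultrahyperbolic equation Δ_x u = Δ_y u. Then for all x, y ∈ ℝ^n and all r ≥ 0, the mean value of u at fixed x over the sphere of radius r in the y-variables equals the mean value of u at fixed y over the sphere of the same radius r in the x-variables: ∫_{|θ|=r} u(x+θ, y) dS_θ = ∫_{|ω|=r} u(x, y+ω) dS_ω. -/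
open MeasureTheory Real Set Filter

noncomputable section

/-- The Laplace operator `Δ = Σ_i ∂²/∂x_i²`. -/
def lap {n : ℕ} (f : (Fin n → ℝ) → ℝ) (x : Fin n → ℝ) : ℝ :=
  ∑ i, pderiv' i (pderiv' i f) x

/-- The surface measure `dS` of the sphere `{θ : |θ| = r}` of radius `r ≥ 0` in `ℝ^n`,
obtained from the unit-sphere surface measure by dilation together with the Jacobian factor
`r^(n-1)`. -/
def sphereMeasureR (n : ℕ) (r : ℝ) : Measure (EuclideanSpace ℝ (Fin n)) :=
  ENNReal.ofReal (r ^ (n - 1)) • Measure.map (fun θ => r • θ) (sphereMeasure n)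


lemma hasDerivAt_int {α : Type*} [TopologicalSpace α] [MeasurableSpace α] [BorelSpace α]
    {μ : Measure α} [IsFiniteMeasure μ] {K : Set α} (hK : IsCompact K) (hμ : ∀ᵐ a ∂μ, a ∈ K)
    {F F' : ℝ → α → ℝ} (hF : Continuous (fun p : ℝ × α => F p.1 p.2))
    (hF' : Continuous (fun p : ℝ × α => F' p.1 p.2))
    (hd : ∀ x a, HasDerivAt (fun t => F t a) (F' x a) x) (x₀ : ℝ) :
    HasDerivAt (fun t => ∫ a, F t a ∂μ) (∫ a, F' x₀ a ∂μ) x₀ := by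
  obtain ⟨M, hM⟩ := ((isCompact_Icc (a := x₀ - 1) (b := x₀ + 1)).prod hK).bddAbove_image
    hF'.norm.continuousOn
  obtain ⟨M', hM'⟩ := ((isCompact_singleton (x := x₀)).prod hK).bddAbove_image
    hF.norm.continuousOn
  have c1 : ∀ x, Continuous (F x) := fun x => hF.comp (by fun_prop : Continuous fun a => (x, a))
  have c2 : ∀ x, Continuous (F' x) := fun x => hF'.comp (by fun_prop : Continuous fun a => (x, a))
  refine (hasDerivAt_integral_of_dominated_loc_of_deriv_le (bound := fun _ => M)
    (Icc_mem_nhds (by linarith : x₀ - 1 < x₀) (by linarith : x₀ < x₀ + 1))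
    (Eventually.of_forall fun x => (c1 x).aestronglyMeasurable) ?_
    (c2 x₀).aestronglyMeasurable ?_ (integrable_const M) ?_).2
  · refine Integrable.of_bound (c1 x₀).aestronglyMeasurable M' ?_
    filter_upwards [hμ] with a ha
    exact hM' ⟨(x₀, a), ⟨rfl, ha⟩, rfl⟩
  · filter_upwards [hμ] with a ha x hx
    exact hM ⟨(x, a), ⟨hx, ha⟩, rfl⟩
  · exact Eventually.of_forall fun a x _ => hd x a

lemma hasDerivAt_interval {F F' : ℝ → ℝ → ℝ} (hF : Continuous (fun p : ℝ × ℝ => F p.1 p.2))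
    (hF' : Continuous (fun p : ℝ × ℝ => F' p.1 p.2))
    (hd : ∀ x a, HasDerivAt (fun t => F t a) (F' x a) x) (a b x₀ : ℝ) :
    HasDerivAt (fun t => ∫ s in a..b, F t s) (∫ s in a..b, F' x₀ s) x₀ := by
  have key : ∀ a b : ℝ, HasDerivAt (fun t => ∫ s in Ioc a b, F t s) (∫ s in Ioc a b, F' x₀ s) x₀ := by
    intro a b
    refine hasDerivAt_int (isCompact_Icc (a := a) (b := b)) ?_ hF hF' hd x₀
    filter_upwards [ae_restrict_mem measurableSet_Ioc] with s hs using Ioc_subset_Icc_self hs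
  exact (key a b).sub (key b a)

lemma leibniz {F F' : ℝ → ℝ → ℝ} (hF : Continuous (fun p : ℝ × ℝ => F p.1 p.2))
    (hF' : Continuous (fun p : ℝ × ℝ => F' p.1 p.2))
    (hd : ∀ x a, HasDerivAt (fun t => F t a) (F' x a) x) (R : ℝ) :
    HasDerivAt (fun t => ∫ s in (0:ℝ)..t, F t s) (F R R + ∫ s in (0:ℝ)..R, F' R s) R := by
  have h := hasStrictFDerivAt_uncurry_coprod (𝕜 := ℝ) (u := ((R, R) : ℝ × ℝ))
    (f := fun t q => ∫ s in (0:ℝ)..q, F t s)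
    (f₁ := fun t q => (ContinuousLinearMap.toSpanSingleton ℝ (∫ s in (0:ℝ)..q, F' t s)))
    (f₂ := fun t q => (ContinuousLinearMap.toSpanSingleton ℝ (F t q)))
    (Eventually.of_forall fun v => (hasDerivAt_interval hF hF' hd 0 v.2 v.1).hasFDerivAt)
    (Eventually.of_forall fun v => by
      have c : Continuous (F v.1) := hF.comp (by fun_prop : Continuous fun a => (v.1, a))
      exact (intervalIntegral.integral_hasDerivAt_right (c.intervalIntegrable _ _)
        (c.stronglyMeasurableAtFilter _ _) c.continuousAt).hasFDerivAt)
    (by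
      apply Continuous.continuousAt
      have : Continuous fun p : ℝ × ℝ => ∫ s in (0:ℝ)..p.2, F' p.1 s :=
        intervalIntegral.continuous_parametric_primitive_of_continuous hF'
      exact (ContinuousLinearMap.toSpanSingletonCLE (𝕜 := ℝ) (E := ℝ)).continuous.comp this)
    (by
      apply Continuous.continuousAt
      exact (ContinuousLinearMap.toSpanSingletonCLE (𝕜 := ℝ) (E := ℝ)).continuous.comp hF)
  have h2 : HasDerivAt (fun t : ℝ => (t, t)) ((1:ℝ), (1:ℝ)) R :=
    (hasDerivAt_id R).prodMk (hasDerivAt_id R)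
  have h3 := h.hasFDerivAt.comp_hasDerivAt_of_eq R h2 rfl
  refine HasDerivAt.congr_deriv h3 ?_
  simp [Function.HasUncurry.uncurry, add_comm]

lemma energy (m : ℕ) {w wr ws wrr wrs wss : ℝ → ℝ → ℝ}
    (cr : Continuous (fun p : ℝ × ℝ => wr p.1 p.2)) (cs : Continuous (fun p : ℝ × ℝ => ws p.1 p.2))
    (crr : Continuous (fun p : ℝ × ℝ => wrr p.1 p.2))
    (crs : Continuous (fun p : ℝ × ℝ => wrs p.1 p.2))
    (css : Continuous (fun p : ℝ × ℝ => wss p.1 p.2))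
    (dws : ∀ r s, HasDerivAt (fun t => w r t) (ws r s) s)
    (drr : ∀ s r, HasDerivAt (fun t => wr t s) (wrr r s) r)
    (drs : ∀ r s, HasDerivAt (fun t => wr r t) (wrs r s) s)
    (dsr : ∀ s r, HasDerivAt (fun t => ws t s) (wrs r s) r)
    (dss : ∀ r s, HasDerivAt (fun t => ws r t) (wss r s) s)
    (pde : ∀ r s, r * s * wrr r s + m * s * wr r s = r * s * wss r s + m * r * ws r s)
    (hdiag : ∀ r, w r r = 0) (hdiag' : ∀ r, wr r r + ws r r = 0) (h0 : ∀ r, ws r 0 = 0)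
    (R : ℝ) (hR : 0 ≤ R) : w R 0 = 0 := by
  let f : ℝ → ℝ → ℝ := fun r s => s ^ m * (wr r s ^ 2 + ws r s ^ 2) / 2
  let f' : ℝ → ℝ → ℝ := fun r s => s ^ m * (wr r s * wrr r s + ws r s * wrs r s)
  have cf : Continuous (fun p : ℝ × ℝ => f p.1 p.2) := by simp only [f]; fun_prop
  have cf' : Continuous (fun p : ℝ × ℝ => f' p.1 p.2) := by simp only [f']; fun_prop
  have df : ∀ r s, HasDerivAt (fun t => f t s) (f' r s) r := by
    intro r s
    have := ((((drr s r).pow 2).add ((dsr s r).pow 2)).const_mul (s ^ m)).div_const 2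
    refine HasDerivAt.congr_deriv this ?_
    simp only [f']; push_cast; ring
  have dE := leibniz cf cf' df
  have hneg : ∀ r, 0 < r → f r r + ∫ s in (0:ℝ)..r, f' r s ≤ 0 := by
    intro r hr
    let g : ℝ → ℝ := fun s => s ^ m * (wr r s * ws r s)
    let g' : ℝ → ℝ := fun s => (m * s ^ (m - 1)) * (wr r s * ws r s)
      + s ^ m * (wrs r s * ws r s + wr r s * wss r s)
    have dg : ∀ s, HasDerivAt g (g' s) s := fun s =>
      (hasDerivAt_pow m s).mul ((drs r s).mul (dss r s))
    have lr : Continuous fun s : ℝ => (r, s) := by fun_prop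
    have cr1 := cr.comp lr
    have cs1 := cs.comp lr
    have crs1 := crs.comp lr
    have css1 := css.comp lr
    simp only [Function.comp_def] at cr1 cs1 crs1 css1
    have cg' : Continuous g' := by simp only [g']; fun_prop
    have e1 : ∫ s in (0:ℝ)..r, g' s = g r - g 0 :=
      intervalIntegral.integral_eq_sub_of_hasDerivAt (fun s _ => dg s)
        (cg'.intervalIntegrable _ _)
    have e2 : ∫ s in (0:ℝ)..r, f' r s ≤ ∫ s in (0:ℝ)..r, g' s := by
      refine intervalIntegral.integral_mono_on_of_le_Ioo hr.le
        ((cf'.comp lr).intervalIntegrable _ _) (cg'.intervalIntegrable _ _) ?_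
      intro s hs
      have hs0 : 0 < s := hs.1
      have hp := pde r s
      have hrr : wrr r s = wss r s + m / s * ws r s - m / r * wr r s := by
        field_simp; linarith
      have hm : (m : ℝ) * s ^ (m - 1) = m / s * s ^ m := by
        rcases Nat.eq_zero_or_pos m with h | h
        · simp [h]
        · obtain ⟨k, rfl⟩ : ∃ k, m = k + 1 := ⟨m - 1, by omega⟩
          simp only [Nat.add_sub_cancel]; field_simp; ring
      have : g' s - f' r s = m / r * s ^ m * wr r s ^ 2 := by
        simp only [g', f', hrr, hm]; ring
      have h3 : 0 ≤ (m:ℝ) / r * s ^ m * wr r s ^ 2 := by positivity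
      linarith
    have e3 : g 0 = 0 := by simp [g, h0]
    have e4 : f r r + g r = 0 := by
      have : f r r + g r = r ^ m * (wr r r + ws r r) ^ 2 / 2 := by simp only [f, g]; ring
      rw [this, hdiag']; simp
    linarith
  have anti : AntitoneOn (fun t => ∫ s in (0:ℝ)..t, f t s) (Ici 0) := by
    apply antitoneOn_of_deriv_nonpos (convex_Ici 0)
    · exact fun t _ => (dE t).continuousAt.continuousWithinAt
    · exact fun t _ => (dE t).differentiableAt.differentiableWithinAt
    · intro t ht
      rw [interior_Ici] at ht
      rw [(dE t).deriv]; exact hneg t ht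
  have hE : ∫ s in (0:ℝ)..R, f R s ≤ 0 := by
    have := anti (mem_Ici.2 le_rfl) (mem_Ici.2 hR) hR
    simpa using this
  have lR : Continuous fun s : ℝ => (R, s) := by fun_prop
  have hws : ∀ s ∈ Icc 0 R, ws R s = 0 := by
    intro s hs
    rcases hs.1.eq_or_lt with h | h
    · rw [← h, h0]
    by_contra hne
    have hRpos : 0 < R := h.trans_le hs.2
    have : 0 < ∫ s in (0:ℝ)..R, f R s := by
      refine intervalIntegral.integral_pos hRpos (cf.comp lR).continuousOn ?_ ⟨s, hs, ?_⟩
      · intro t ht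
        have := ht.1
        simp only [f]; positivity
      · simp only [f]; positivity
    linarith
  have hc := constant_of_derivWithin_zero (f := w R) (a := 0) (b := R)
    (fun t _ => (dws R t).differentiableAt.differentiableWithinAt)
    (fun t ht => by
      rw [(dws R t).hasDerivWithinAt.derivWithin (uniqueDiffOn_Icc (ht.1.trans_lt ht.2) t ⟨ht.1, ht.2.le⟩)]
      exact hws t ⟨ht.1, ht.2.le⟩)
  have := hc R ⟨hR, le_rfl⟩
  rw [← this, hdiag]

open Metric in
lemma sphere_inv {n : ℕ} (U : EuclideanSpace ℝ (Fin n) ≃ₗᵢ[ℝ] EuclideanSpace ℝ (Fin n))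
    {F : EuclideanSpace ℝ (Fin n) → ℝ} (hF : Continuous F) :
    ∫ θ : sphere (0 : EuclideanSpace ℝ (Fin n)) 1, F (U θ)
        ∂((volume : Measure (EuclideanSpace ℝ (Fin n))).toSphere)
      = ∫ θ : sphere (0 : EuclideanSpace ℝ (Fin n)) 1, F θ
        ∂((volume : Measure (EuclideanSpace ℝ (Fin n))).toSphere) := by
  let e : sphere (0 : EuclideanSpace ℝ (Fin n)) 1 → sphere (0 : EuclideanSpace ℝ (Fin n)) 1 :=
    fun θ => ⟨U θ, by simp⟩
  have he : Continuous e := by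
    apply Continuous.subtype_mk
    fun_prop
  have hm : Measure.map e ((volume : Measure (EuclideanSpace ℝ (Fin n))).toSphere)
      = (volume : Measure (EuclideanSpace ℝ (Fin n))).toSphere := by
    ext s hs
    rw [Measure.map_apply he.measurable hs, Measure.toSphere_apply' _ hs,
      Measure.toSphere_apply' _ (he.measurable hs)]
    congr 1
    refine Eq.trans ?_ (MeasurePreserving.measure_preimage_equiv (f := U.toMeasurableEquiv)
      U.measurePreserving _)
    congr 1
    ext z
    simp only [Set.mem_smul, mem_preimage, Set.mem_image]
    constructor
    · rintro ⟨t, ht, _, ⟨θ, hθ, rfl⟩, rfl⟩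
      exact ⟨t, ht, _, ⟨e θ, hθ, rfl⟩, by simp [e]⟩
    · rintro ⟨t, ht, _, ⟨θ, hθ, rfl⟩, h⟩
      have h' : t • (θ : EuclideanSpace ℝ (Fin n)) = U z := h
      refine ⟨t, ht, U.symm θ, ⟨⟨U.symm θ, by simp⟩, ?_, rfl⟩, ?_⟩
      · have : e ⟨U.symm θ, by simp⟩ = θ := by ext1; simp [e]
        simpa [this] using hθ
      · rw [← map_smul, h']; simp
  conv_rhs => rw [← hm]
  rw [integral_map he.aemeasurable (by
    exact (hF.comp continuous_subtype_val).aestronglyMeasurable)]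

/-- Rotation in the `(i, j)` coordinate plane. -/
def rotLin {n : ℕ} (i j : Fin n) (t : ℝ) :
    EuclideanSpace ℝ (Fin n) →ₗ[ℝ] EuclideanSpace ℝ (Fin n) where
  toFun z := z + ((cos t - 1) • (z i • EuclideanSpace.single i (1:ℝ) + z j • EuclideanSpace.single j 1)
    + sin t • (z i • EuclideanSpace.single j 1 - z j • EuclideanSpace.single i 1))
  map_add' z z' := by simp only [PiLp.add_apply]; module
  map_smul' c z := by simp only [PiLp.smul_apply, smul_eq_mul, RingHom.id_apply]; module

lemma rotLin_apply {n : ℕ} (i j : Fin n) (t : ℝ) (z : EuclideanSpace ℝ (Fin n)) :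
    rotLin i j t z = z + ((cos t - 1) • (z i • EuclideanSpace.single i (1:ℝ) + z j • EuclideanSpace.single j 1)
    + sin t • (z i • EuclideanSpace.single j 1 - z j • EuclideanSpace.single i 1)) := rfl

lemma rotLin_norm {n : ℕ} {i j : Fin n} (hij : i ≠ j) (t : ℝ) (z : EuclideanSpace ℝ (Fin n)) :
    ‖rotLin i j t z‖ = ‖z‖ := by
  have h : ‖rotLin i j t z‖ ^ 2 = ‖z‖ ^ 2 := by
    rw [← real_inner_self_eq_norm_sq, ← real_inner_self_eq_norm_sq, rotLin_apply]
    simp only [inner_add_left, inner_add_right, inner_sub_left, inner_sub_right,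
      real_inner_smul_left, real_inner_smul_right, EuclideanSpace.inner_single_left,
      EuclideanSpace.inner_single_right]
    simp [hij, hij.symm]
    linear_combination (z i ^ 2 + z j ^ 2) * sin_sq_add_cos_sq t
  exact (sq_eq_sq₀ (norm_nonneg _) (norm_nonneg _)).1 h

def rot {n : ℕ} {i j : Fin n} (hij : i ≠ j) (t : ℝ) :
    EuclideanSpace ℝ (Fin n) ≃ₗᵢ[ℝ] EuclideanSpace ℝ (Fin n) :=
  LinearIsometry.toLinearIsometryEquiv ⟨rotLin i j t, rotLin_norm hij t⟩ rfl

lemma rot_apply {n : ℕ} {i j : Fin n} (hij : i ≠ j) (t : ℝ) (z : EuclideanSpace ℝ (Fin n)) :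
    rot hij t z = z + ((cos t - 1) • (z i • EuclideanSpace.single i (1:ℝ) + z j • EuclideanSpace.single j 1)
    + sin t • (z i • EuclideanSpace.single j 1 - z j • EuclideanSpace.single i 1)) := rfl

open Metric in
lemma sphere_ibp {n : ℕ} (i j : Fin n) {g : EuclideanSpace ℝ (Fin n) → ℝ}
    (hg : ContDiff ℝ 1 g) :
    ∫ θ : sphere (0 : EuclideanSpace ℝ (Fin n)) 1,
      ((θ : EuclideanSpace ℝ (Fin n)) i * fderiv ℝ g θ (EuclideanSpace.single j 1)
        - (θ : EuclideanSpace ℝ (Fin n)) j * fderiv ℝ g θ (EuclideanSpace.single i 1))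
        ∂((volume : Measure (EuclideanSpace ℝ (Fin n))).toSphere) = 0 := by
  by_cases hij : i = j
  · subst hij; simp
  have cD : Continuous (fderiv ℝ g) := hg.continuous_fderiv (by norm_num)
  have dg : Differentiable ℝ g := hg.differentiable (by norm_num)
  have cc : ∀ k, Continuous fun z : EuclideanSpace ℝ (Fin n) => z k := fun k => by fun_prop
  obtain ⟨c, hcdef⟩ : ∃ c : ℝ → EuclideanSpace ℝ (Fin n) → EuclideanSpace ℝ (Fin n),
    c = fun t z => rot hij t z := ⟨_, rfl⟩
  obtain ⟨c', hcdef'⟩ : ∃ c' : ℝ → EuclideanSpace ℝ (Fin n) → EuclideanSpace ℝ (Fin n),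
    c' = fun t z =>
    (- sin t) • (z i • EuclideanSpace.single i (1:ℝ) + z j • EuclideanSpace.single j 1)
    + cos t • (z i • EuclideanSpace.single j 1 - z j • EuclideanSpace.single i 1) := ⟨_, rfl⟩
  have hc : ∀ t z, HasDerivAt (fun t => c t z) (c' t z) t := by
    intro t z
    simp only [hcdef, rot_apply, hcdef']
    refine HasDerivAt.const_add _ (HasDerivAt.add ?_ ?_)
    · exact ((hasDerivAt_cos t).sub_const 1).smul_const _
    · exact (hasDerivAt_sin t).smul_const _
  have ccont : Continuous fun p : ℝ × EuclideanSpace ℝ (Fin n) => c p.1 p.2 := by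
    simp only [hcdef, rot_apply]; fun_prop
  have ccont' : Continuous fun p : ℝ × EuclideanSpace ℝ (Fin n) => c' p.1 p.2 := by
    simp only [hcdef']; fun_prop
  have lift : Continuous fun p : ℝ × sphere (0 : EuclideanSpace ℝ (Fin n)) 1 =>
    (p.1, (p.2 : EuclideanSpace ℝ (Fin n))) := by fun_prop
  have k1 : Continuous fun p : ℝ × sphere (0 : EuclideanSpace ℝ (Fin n)) 1 => g (c p.1 p.2) :=
    (dg.continuous.comp ccont).comp lift
  have k2 : Continuous fun p : ℝ × sphere (0 : EuclideanSpace ℝ (Fin n)) 1 =>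
      fderiv ℝ g (c p.1 p.2) (c' p.1 p.2) :=
    ((cD.comp ccont).clm_apply ccont').comp lift
  have k3 : ∀ (t : ℝ) (θ : sphere (0 : EuclideanSpace ℝ (Fin n)) 1),
      HasDerivAt (fun t => g (c t θ)) (fderiv ℝ g (c t θ) (c' t θ)) t := fun t θ =>
    (dg (c t θ)).hasFDerivAt.comp_hasDerivAt t (hc t θ)
  have key := hasDerivAt_int (μ := (volume : Measure (EuclideanSpace ℝ (Fin n))).toSphere)
    isCompact_univ (Eventually.of_forall fun a => mem_univ a) k1 k2 k3 0
  have hconst : (fun t => ∫ θ : sphere (0 : EuclideanSpace ℝ (Fin n)) 1, g (c t θ)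
      ∂((volume : Measure (EuclideanSpace ℝ (Fin n))).toSphere)) = fun _ =>
      ∫ θ : sphere (0 : EuclideanSpace ℝ (Fin n)) 1, g θ
        ∂((volume : Measure (EuclideanSpace ℝ (Fin n))).toSphere) := by
    funext t
    rw [hcdef]
    exact sphere_inv (rot hij t) dg.continuous
  rw [hconst] at key
  have h0 := key.unique (hasDerivAt_const 0 _)
  rw [← h0]
  congr 1
  funext θ
  have e1 : c 0 θ = θ := by simp [hcdef, rot_apply]
  have e2 : c' 0 θ = (θ : EuclideanSpace ℝ (Fin n)) i • EuclideanSpace.single j 1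
    - (θ : EuclideanSpace ℝ (Fin n)) j • EuclideanSpace.single i 1 := by simp [hcdef']
  rw [e1, e2]; simp

abbrev EE (n : ℕ) := EuclideanSpace ℝ (Fin n)

abbrev SS (n : ℕ) := Metric.sphere (0 : EE n) 1

def sg (n : ℕ) : Measure (SS n) := (volume : Measure (EE n)).toSphere

instance (n : ℕ) : IsFiniteMeasure (sg n) := by unfold sg; infer_instance

lemma integrable_cpt {α : Type*} [TopologicalSpace α] [CompactSpace α] [MeasurableSpace α]
    [BorelSpace α] {μ : Measure α} [IsFiniteMeasure μ] {f : α → ℝ} (hf : Continuous f) :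
    Integrable f μ :=
  hf.integrable_of_hasCompactSupport (HasCompactSupport.of_compactSpace _)

lemma sum_single_eq {n : ℕ} (z : EE n) : z = ∑ i, z i • EuclideanSpace.single i (1:ℝ) := by
  ext k
  simp [Pi.single_apply]

lemma darboux {n : ℕ} {a : EE n → EE n →L[ℝ] ℝ} (ha : ContDiff ℝ 1 a) (r : ℝ) :
    ∫ θ : SS n, r * ∑ i, fderiv ℝ a (r • (θ : EE n)) (EuclideanSpace.single i 1)
        (EuclideanSpace.single i 1) ∂(sg n)
      = ∫ θ : SS n, (((n : ℝ) - 1) * a (r • (θ : EE n)) θ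
        + r * fderiv ℝ a (r • (θ : EE n)) θ θ) ∂(sg n) := by
  have da : Differentiable ℝ a := ha.differentiable (by norm_num)
  have cD : Continuous (fderiv ℝ a) := ha.continuous_fderiv (by norm_num)
  have ca : Continuous a := ha.continuous
  have hg : ∀ i j : Fin n, ContDiff ℝ 1
      (fun z : EE n => z i * a (r • z) (EuclideanSpace.single j 1)) := by
    intro i j
    have : ContDiff ℝ 1 fun z : EE n => a (r • z) := ha.comp (contDiff_const_smul r)
    exact ContDiff.mul (by fun_prop) (this.clm_apply contDiff_const)
  have hfd : ∀ (i j : Fin n) (z v : EE n),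
      fderiv ℝ (fun z : EE n => z i * a (r • z) (EuclideanSpace.single j 1)) z v
        = v i * a (r • z) (EuclideanSpace.single j 1)
          + z i * (r * fderiv ℝ a (r • z) v (EuclideanSpace.single j 1)) := by
    intro i j z v
    have h1 : HasFDerivAt (fun z : EE n => z i) (EuclideanSpace.proj (𝕜 := ℝ) i) z :=
      (EuclideanSpace.proj (𝕜 := ℝ) i : EE n →L[ℝ] ℝ).hasFDerivAt
    have h2 : HasFDerivAt (fun z : EE n => r • z) (r • ContinuousLinearMap.id ℝ (EE n)) z :=
      (hasFDerivAt_id z).const_smul r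
    have h3 : HasFDerivAt (fun z : EE n => a (r • z))
      ((fderiv ℝ a (r • z)).comp (r • ContinuousLinearMap.id ℝ (EE n))) z :=
      HasFDerivAt.comp z (da (r • z)).hasFDerivAt h2
    have h4 := h3.clm_apply (hasFDerivAt_const (EuclideanSpace.single j (1:ℝ)) z)
    have h5 : HasFDerivAt (fun z : EE n => z i * a (r • z) (EuclideanSpace.single j 1)) _ z :=
      h1.mul h4
    rw [h5.fderiv]
    simp
    ring
  have hI : ∀ i j : Fin n, ∫ θ : SS n,
      ((θ : EE n) i * (((EuclideanSpace.single j 1 : EE n) i)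
            * a (r • (θ : EE n)) (EuclideanSpace.single j 1)
          + (θ : EE n) i * (r * fderiv ℝ a (r • (θ : EE n)) (EuclideanSpace.single j 1)
              (EuclideanSpace.single j 1)))
        - (θ : EE n) j * (((EuclideanSpace.single i 1 : EE n) i)
            * a (r • (θ : EE n)) (EuclideanSpace.single j 1)
          + (θ : EE n) i * (r * fderiv ℝ a (r • (θ : EE n)) (EuclideanSpace.single i 1)
              (EuclideanSpace.single j 1)))) ∂(sg n) = 0 := by
    intro i j
    have := sphere_ibp i j (hg i j)
    simp only [hfd] at this
    exact this
  have cθ : Continuous fun θ : SS n => a (r • (θ : EE n)) := by fun_prop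
  have cDθ : Continuous fun θ : SS n => fderiv ℝ a (r • (θ : EE n)) := by fun_prop
  have hsum := Finset.sum_eq_zero (s := (Finset.univ : Finset (Fin n))) fun i _ =>
    Finset.sum_eq_zero (s := (Finset.univ : Finset (Fin n))) fun j _ => hI i j
  have hcont : ∀ i j : Fin n, Continuous fun θ : SS n =>
      ((θ : EE n) i * (((EuclideanSpace.single j 1 : EE n) i)
            * a (r • (θ : EE n)) (EuclideanSpace.single j 1)
          + (θ : EE n) i * (r * fderiv ℝ a (r • (θ : EE n)) (EuclideanSpace.single j 1)
              (EuclideanSpace.single j 1)))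
        - (θ : EE n) j * (((EuclideanSpace.single i 1 : EE n) i)
            * a (r • (θ : EE n)) (EuclideanSpace.single j 1)
          + (θ : EE n) i * (r * fderiv ℝ a (r • (θ : EE n)) (EuclideanSpace.single i 1)
              (EuclideanSpace.single j 1)))) := by
    intro i j; fun_prop
  simp_rw [← integral_finsetSum _ fun j _ => integrable_cpt (μ := sg n) (hcont _ j)] at hsum
  rw [← integral_finsetSum _ fun i _ => integrable_cpt (μ := sg n)
    (continuous_finsetSum _ fun j _ => hcont i j)] at hsum
  rw [← sub_eq_zero, ← integral_sub, ← hsum]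
  rotate_left
  · exact integrable_cpt (by fun_prop)
  · exact integrable_cpt (by fun_prop)
  congr 1
  funext θ
  have hnorm : ∑ i, (θ : EE n) i * (θ : EE n) i = 1 := by
    have h1 : ‖(θ : EE n)‖ ^ 2 = 1 := by simp
    rw [EuclideanSpace.norm_sq_eq] at h1
    rw [← h1]
    exact Finset.sum_congr rfl fun i _ => by rw [Real.norm_eq_abs, sq_abs, sq]
  obtain ⟨A, hA⟩ : ∃ A : EE n →L[ℝ] ℝ, A = a (r • (θ : EE n)) := ⟨_, rfl⟩
  obtain ⟨B, hB⟩ : ∃ B : EE n →L[ℝ] EE n →L[ℝ] ℝ, B = fderiv ℝ a (r • (θ : EE n)) := ⟨_, rfl⟩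
  rw [← hA, ← hB]
  obtain ⟨z, hz⟩ : ∃ z : EE n, z = θ := ⟨_, rfl⟩
  rw [← hz] at hnorm ⊢
  have hAz : A z = ∑ j, z j * A (EuclideanSpace.single j 1) := by
    conv_lhs => rw [sum_single_eq z]
    simp
  have hBz : B z z = ∑ i, ∑ j, z j * (z i * B (EuclideanSpace.single i 1) (EuclideanSpace.single j 1)) := by
    conv_lhs => rw [sum_single_eq z]
    simp only [map_sum, map_smul, sum_apply, smul_apply,
      smul_eq_mul, Finset.mul_sum]
    rw [Finset.sum_comm]
  have t1 : ∑ i, ∑ j, z i * ((EuclideanSpace.single j 1 : EE n) i * A (EuclideanSpace.single j 1))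
      = A z := by
    rw [hAz]
    simp [PiLp.single_apply]
  have t2 : ∑ i, ∑ j, z i * (z i * (r * B (EuclideanSpace.single j 1) (EuclideanSpace.single j 1)))
      = r * ∑ j, B (EuclideanSpace.single j 1) (EuclideanSpace.single j 1) := by
    have : ∀ i, ∑ j, z i * (z i * (r * B (EuclideanSpace.single j 1) (EuclideanSpace.single j 1)))
      = (z i * z i) * (r * ∑ j, B (EuclideanSpace.single j 1) (EuclideanSpace.single j 1)) := by
      intro i
      rw [Finset.mul_sum, Finset.mul_sum]
      exact Finset.sum_congr rfl fun j _ => by ring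
    simp_rw [this]
    rw [← Finset.sum_mul, hnorm, one_mul]
  have t3 : ∑ i : Fin n, ∑ j, z j * ((EuclideanSpace.single i 1 : EE n) i * A (EuclideanSpace.single j 1))
      = n * A z := by
    rw [hAz]; simp
  have t4 : ∑ i, ∑ j, z j * (z i * (r * B (EuclideanSpace.single i 1) (EuclideanSpace.single j 1)))
      = r * B z z := by
    rw [hBz, Finset.mul_sum]
    refine Finset.sum_congr rfl fun i _ => ?_
    rw [Finset.mul_sum]
    exact Finset.sum_congr rfl fun j _ => by ring
  simp only [mul_add, Finset.sum_sub_distrib, Finset.sum_add_distrib, t1, t2, t3, t4]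
  ring

lemma cont_int {α : Type*} [TopologicalSpace α] [CompactSpace α] [MeasurableSpace α]
    [BorelSpace α] {μ : Measure α} [IsFiniteMeasure μ] {G : ℝ × ℝ → α → ℝ}
    (hG : Continuous (fun p : (ℝ × ℝ) × α => G p.1 p.2)) :
    Continuous fun p : ℝ × ℝ => ∫ a, G p a ∂μ := by
  have := continuous_parametric_integral_of_continuous (μ := μ) (f := G) hG isCompact_univ
  simpa using this

lemma dI {n : ℕ} {Φ : SS n × SS n → EE n × EE n → ℝ}
    {Φ' : SS n × SS n → EE n × EE n → (EE n × EE n →L[ℝ] ℝ)}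
    (c : Continuous fun q : (SS n × SS n) × (EE n × EE n) => Φ q.1 q.2)
    (c' : Continuous fun q : (SS n × SS n) × (EE n × EE n) => Φ' q.1 q.2)
    (h : ∀ a p, HasFDerivAt (Φ a) (Φ' a p) p) :
    (∀ r s : ℝ, HasDerivAt (fun t : ℝ => ∫ a : SS n × SS n, Φ a (t • (a.1 : EE n), s • (a.2 : EE n))
        ∂((sg n).prod (sg n)))
      (∫ a : SS n × SS n, Φ' a (r • (a.1 : EE n), s • (a.2 : EE n)) ((a.1 : EE n), 0)
        ∂((sg n).prod (sg n))) r) ∧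
    (∀ r s : ℝ, HasDerivAt (fun t : ℝ => ∫ a : SS n × SS n, Φ a (r • (a.1 : EE n), t • (a.2 : EE n))
        ∂((sg n).prod (sg n)))
      (∫ a : SS n × SS n, Φ' a (r • (a.1 : EE n), s • (a.2 : EE n)) (0, (a.2 : EE n))
        ∂((sg n).prod (sg n))) s) := by
  constructor
  · intro r s
    have l : Continuous fun q : ℝ × (SS n × SS n) =>
      (q.2, ((q.1 • (q.2.1 : EE n), s • (q.2.2 : EE n)) : EE n × EE n)) := by fun_prop
    refine hasDerivAt_int isCompact_univ (Eventually.of_forall fun a => mem_univ a)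
      (F := fun t (a : SS n × SS n) => Φ a (t • (a.1 : EE n), s • (a.2 : EE n)))
      (F' := fun t (a : SS n × SS n) =>
        Φ' a (t • (a.1 : EE n), s • (a.2 : EE n)) ((a.1 : EE n), 0)) (c.comp l) ?_ ?_ r
    · exact (c'.comp l).clm_apply (by fun_prop)
    · intro t a
      have h1 : HasDerivAt (fun t : ℝ => ((t • (a.1 : EE n), s • (a.2 : EE n)) : EE n × EE n))
          ((a.1 : EE n), 0) t := by
        have := ((hasDerivAt_id t).smul_const (a.1 : EE n)).prodMk
          (hasDerivAt_const t (s • (a.2 : EE n)))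
        simpa using this
      exact (h a _).comp_hasDerivAt t h1
  · intro r s
    have l : Continuous fun q : ℝ × (SS n × SS n) =>
      (q.2, ((r • (q.2.1 : EE n), q.1 • (q.2.2 : EE n)) : EE n × EE n)) := by fun_prop
    refine hasDerivAt_int isCompact_univ (Eventually.of_forall fun a => mem_univ a)
      (F := fun t (a : SS n × SS n) => Φ a (r • (a.1 : EE n), t • (a.2 : EE n)))
      (F' := fun t (a : SS n × SS n) =>
        Φ' a (r • (a.1 : EE n), t • (a.2 : EE n)) (0, (a.2 : EE n))) (c.comp l) ?_ ?_ s
    · exact (c'.comp l).clm_apply (by fun_prop)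
    · intro t a
      have h1 : HasDerivAt (fun t : ℝ => ((r • (a.1 : EE n), t • (a.2 : EE n)) : EE n × EE n))
          (0, (a.2 : EE n)) t := by
        have := (hasDerivAt_const t (r • (a.1 : EE n))).prodMk
          ((hasDerivAt_id t).smul_const (a.2 : EE n))
        simpa using this
      exact (h a _).comp_hasDerivAt t h1

/-- Darboux equation in the first variable. -/
lemma darboux1 {n : ℕ} {D : EE n × EE n → (EE n × EE n →L[ℝ] ℝ)} (hD : ContDiff ℝ 1 D)
    (r : ℝ) (q : EE n) :
    ∫ θ : SS n, r * ∑ i, fderiv ℝ D (r • (θ : EE n), q) (EuclideanSpace.single i 1, 0)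
        (EuclideanSpace.single i 1, 0) ∂(sg n)
      = ∫ θ : SS n, (((n : ℝ) - 1) * D (r • (θ : EE n), q) ((θ : EE n), 0)
        + r * fderiv ℝ D (r • (θ : EE n), q) ((θ : EE n), 0) ((θ : EE n), 0)) ∂(sg n) := by
  let J : (EE n × EE n →L[ℝ] ℝ) →L[ℝ] (EE n →L[ℝ] ℝ) :=
    (ContinuousLinearMap.compL ℝ (EE n) (EE n × EE n) ℝ).flip (ContinuousLinearMap.inl ℝ _ _)
  have hc : ContDiff ℝ 1 (fun p : EE n => J (D (p, q))) :=
    J.contDiff.comp (hD.comp (contDiff_id.prodMk contDiff_const))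
  have hf : ∀ p v w : EE n, fderiv ℝ (fun p : EE n => J (D (p, q))) p v w
      = fderiv ℝ D (p, q) (v, 0) (w, 0) := by
    intro p v w
    have h1 : HasFDerivAt (fun p : EE n => ((p, q) : EE n × EE n))
      (ContinuousLinearMap.inl ℝ _ _) p := hasFDerivAt_prodMk_left p q
    have h2 := HasFDerivAt.comp p ((hD.differentiable (by norm_num)) (p, q)).hasFDerivAt h1
    have h3 : HasFDerivAt (fun p : EE n => J (D (p, q))) _ p := HasFDerivAt.comp p J.hasFDerivAt h2
    rw [h3.fderiv]
    simp [J]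
  have := darboux hc r
  simp only [hf] at this
  simpa [J] using this

lemma darboux2 {n : ℕ} {D : EE n × EE n → (EE n × EE n →L[ℝ] ℝ)} (hD : ContDiff ℝ 1 D)
    (r : ℝ) (q : EE n) :
    ∫ θ : SS n, r * ∑ i, fderiv ℝ D (q, r • (θ : EE n)) (0, EuclideanSpace.single i 1)
        (0, EuclideanSpace.single i 1) ∂(sg n)
      = ∫ θ : SS n, (((n : ℝ) - 1) * D (q, r • (θ : EE n)) (0, (θ : EE n))
        + r * fderiv ℝ D (q, r • (θ : EE n)) (0, (θ : EE n)) (0, (θ : EE n))) ∂(sg n) := by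
  let J : (EE n × EE n →L[ℝ] ℝ) →L[ℝ] (EE n →L[ℝ] ℝ) :=
    (ContinuousLinearMap.compL ℝ (EE n) (EE n × EE n) ℝ).flip (ContinuousLinearMap.inr ℝ _ _)
  have hc : ContDiff ℝ 1 (fun p : EE n => J (D (q, p))) :=
    J.contDiff.comp (hD.comp (contDiff_const.prodMk contDiff_id))
  have hf : ∀ p v w : EE n, fderiv ℝ (fun p : EE n => J (D (q, p))) p v w
      = fderiv ℝ D (q, p) (0, v) (0, w) := by
    intro p v w
    have h1 : HasFDerivAt (fun p : EE n => ((q, p) : EE n × EE n))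
      (ContinuousLinearMap.inr ℝ _ _) p := hasFDerivAt_prodMk_right q p
    have h2 := HasFDerivAt.comp p ((hD.differentiable (by norm_num)) (q, p)).hasFDerivAt h1
    have h3 : HasFDerivAt (fun p : EE n => J (D (q, p))) _ p := HasFDerivAt.comp p J.hasFDerivAt h2
    rw [h3.fderiv]
    simp [J]
  have := darboux hc r
  simp only [hf] at this
  simpa [J] using this

lemma odd_int {n : ℕ} (L : EE n →L[ℝ] ℝ) : ∫ θ : SS n, L (θ : EE n) ∂(sg n) = 0 := by
  have h := sphere_inv (LinearIsometryEquiv.neg ℝ (E := EE n)) L.continuous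
  simp only [LinearIsometryEquiv.coe_neg, map_neg] at h
  rw [integral_neg] at h
  unfold sg
  linarith

lemma main_sphere {n : ℕ} (hn : 0 < n) {H : EE n × EE n → ℝ} (hH : ContDiff ℝ 2 H)
    (hpde : ∀ p, ∑ i, fderiv ℝ (fderiv ℝ H) p (EuclideanSpace.single i 1, 0)
        (EuclideanSpace.single i 1, 0)
      = ∑ i, fderiv ℝ (fderiv ℝ H) p (0, EuclideanSpace.single i 1)
        (0, EuclideanSpace.single i 1)) (R : ℝ) (hR : 0 ≤ R) :
    ∫ θ : SS n, H (R • (θ : EE n), 0) ∂(sg n) = ∫ θ : SS n, H (0, R • (θ : EE n)) ∂(sg n) := by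
  have cH : Continuous H := hH.continuous
  have dH : Differentiable ℝ H := hH.differentiable (by norm_num)
  have hD : ContDiff ℝ 1 (fderiv ℝ H) := hH.fderiv_right (by norm_num)
  have hsymm : ∀ p v w, fderiv ℝ (fderiv ℝ H) p v w = fderiv ℝ (fderiv ℝ H) p w v := fun p v w =>
    (hH.contDiffAt.isSymmSndFDerivAt (by simp)) v w
  obtain ⟨D, hDdef⟩ : ∃ D, D = fderiv ℝ H := ⟨_, rfl⟩
  have hHD : ∀ p, HasFDerivAt H (D p) p := fun p => hDdef ▸ (dH p).hasFDerivAt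
  rw [← hDdef] at hD hpde hsymm
  have cD : Continuous D := hD.continuous
  have dD : Differentiable ℝ D := hD.differentiable (by norm_num)
  have cT : Continuous (fderiv ℝ D) := hD.continuous_fderiv (by norm_num)
  obtain ⟨T, hTdef⟩ : ∃ T, T = fderiv ℝ D := ⟨_, rfl⟩
  have hDT : ∀ p, HasFDerivAt D (T p) p := fun p => hTdef ▸ (dD p).hasFDerivAt
  have db1 := fun r q => darboux1 hD r q
  have db2 := fun r q => darboux2 hD r q
  rw [← hTdef] at cT hpde hsymm db1 db2
  -- the functions
  obtain ⟨v, hv⟩ : ∃ v : ℝ → ℝ → ℝ, v = fun r s => ∫ a : SS n × SS n,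
    H (r • (a.1 : EE n), s • (a.2 : EE n)) ∂((sg n).prod (sg n)) := ⟨_, rfl⟩
  obtain ⟨vr, hvr⟩ : ∃ v : ℝ → ℝ → ℝ, v = fun r s => ∫ a : SS n × SS n,
    D (r • (a.1 : EE n), s • (a.2 : EE n)) ((a.1 : EE n), 0) ∂((sg n).prod (sg n)) := ⟨_, rfl⟩
  obtain ⟨vs, hvs⟩ : ∃ v : ℝ → ℝ → ℝ, v = fun r s => ∫ a : SS n × SS n,
    D (r • (a.1 : EE n), s • (a.2 : EE n)) (0, (a.2 : EE n)) ∂((sg n).prod (sg n)) := ⟨_, rfl⟩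
  obtain ⟨vrr, hvrr⟩ : ∃ v : ℝ → ℝ → ℝ, v = fun r s => ∫ a : SS n × SS n,
    T (r • (a.1 : EE n), s • (a.2 : EE n)) ((a.1 : EE n), 0) ((a.1 : EE n), 0)
      ∂((sg n).prod (sg n)) := ⟨_, rfl⟩
  obtain ⟨vrs, hvrs⟩ : ∃ v : ℝ → ℝ → ℝ, v = fun r s => ∫ a : SS n × SS n,
    T (r • (a.1 : EE n), s • (a.2 : EE n)) ((a.1 : EE n), 0) (0, (a.2 : EE n))
      ∂((sg n).prod (sg n)) := ⟨_, rfl⟩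
  obtain ⟨vss, hvss⟩ : ∃ v : ℝ → ℝ → ℝ, v = fun r s => ∫ a : SS n × SS n,
    T (r • (a.1 : EE n), s • (a.2 : EE n)) (0, (a.2 : EE n)) (0, (a.2 : EE n))
      ∂((sg n).prod (sg n)) := ⟨_, rfl⟩
  -- continuity
  have cvr : Continuous fun p : ℝ × ℝ => vr p.1 p.2 := by
    rw [hvr]; exact cont_int (by fun_prop)
  have cvs : Continuous fun p : ℝ × ℝ => vs p.1 p.2 := by
    rw [hvs]; exact cont_int (by fun_prop)
  have cvrr : Continuous fun p : ℝ × ℝ => vrr p.1 p.2 := by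
    rw [hvrr]; exact cont_int (by fun_prop)
  have cvrs : Continuous fun p : ℝ × ℝ => vrs p.1 p.2 := by
    rw [hvrs]; exact cont_int (by fun_prop)
  have cvss : Continuous fun p : ℝ × ℝ => vss p.1 p.2 := by
    rw [hvss]; exact cont_int (by fun_prop)
  -- derivatives
  have d0 := dI (n := n) (Φ := fun _ p => H p) (Φ' := fun _ p => D p) (by fun_prop) (by fun_prop)
    (fun _ p => hHD p)
  have d1 := dI (n := n) (Φ := fun a p => D p ((a.1 : EE n), 0))
    (Φ' := fun a p => (T p).flip ((a.1 : EE n), 0)) (by fun_prop)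
    (((ContinuousLinearMap.flipₗᵢ ℝ (EE n × EE n) (EE n × EE n) ℝ).continuous.comp
      (cT.comp continuous_snd)).clm_apply (by fun_prop))
    (fun a p => by simpa using (hDT p).clm_apply (hasFDerivAt_const (((a.1 : EE n), 0) : EE n × EE n) p))
  have d2 := dI (n := n) (Φ := fun a p => D p (0, (a.2 : EE n)))
    (Φ' := fun a p => (T p).flip (0, (a.2 : EE n))) (by fun_prop)
    (((ContinuousLinearMap.flipₗᵢ ℝ (EE n × EE n) (EE n × EE n) ℝ).continuous.comp
      (cT.comp continuous_snd)).clm_apply (by fun_prop))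
    (fun a p => by simpa using (hDT p).clm_apply (hasFDerivAt_const ((0, (a.2 : EE n)) : EE n × EE n) p))
  simp only [ContinuousLinearMap.flip_apply] at d1 d2
  have dvr : ∀ r s, HasDerivAt (fun t => v t s) (vr r s) r := by
    rw [hv, hvr]; exact d0.1
  have dvs : ∀ r s, HasDerivAt (fun t => v r t) (vs r s) s := by
    rw [hv, hvs]; exact d0.2
  have dvrr : ∀ r s, HasDerivAt (fun t => vr t s) (vrr r s) r := by
    rw [hvr, hvrr]; exact d1.1
  have dvrs : ∀ r s, HasDerivAt (fun t => vr r t) (vrs r s) s := by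
    rw [hvr, hvrs]; intro r s; refine (d1.2 r s).congr_deriv ?_
    congr 1; funext a; exact hsymm _ _ _
  have dvsr : ∀ r s, HasDerivAt (fun t => vs t s) (vrs r s) r := by
    rw [hvs, hvrs]; exact d2.1
  have dvss : ∀ r s, HasDerivAt (fun t => vs r t) (vss r s) s := by
    rw [hvs, hvss]; exact d2.2
  -- vanishing
  have vs0 : ∀ r, vs r 0 = 0 := by
    intro r
    rw [hvs]
    simp only [zero_smul]
    rw [integral_prod _ (integrable_cpt (by fun_prop))]
    have : ∀ θ : SS n, ∫ ω : SS n, D (r • (θ : EE n), 0) (0, (ω : EE n)) ∂(sg n) = 0 := fun θ => by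
      simpa using odd_int ((D (r • (θ : EE n), 0)).comp (ContinuousLinearMap.inr ℝ _ _))
    simp [this]
  have vr0 : ∀ s, vr 0 s = 0 := by
    intro s
    rw [hvr]
    simp only [zero_smul]
    rw [integral_prod_symm _ (integrable_cpt (by fun_prop))]
    have : ∀ θ : SS n, ∫ ω : SS n, D (0, s • (θ : EE n)) ((ω : EE n), 0) ∂(sg n) = 0 := fun θ => by
      simpa using odd_int ((D (0, s • (θ : EE n))).comp (ContinuousLinearMap.inl ℝ _ _))
    simp [this]
  -- the PDE
  have p1 : ∀ r s, ((n : ℝ) - 1) * vr r s + r * vrr r s = r * ∫ a : SS n × SS n,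
      ∑ i, T (r • (a.1 : EE n), s • (a.2 : EE n)) (EuclideanSpace.single i 1, 0)
        (EuclideanSpace.single i 1, 0) ∂((sg n).prod (sg n)) := by
    intro r s
    rw [hvr, hvrr]
    simp only
    rw [← integral_const_mul, ← integral_const_mul, ← integral_const_mul,
      ← integral_add (integrable_cpt (by fun_prop)) (integrable_cpt (by fun_prop)),
      integral_prod_symm _ (integrable_cpt (by fun_prop)),
      integral_prod_symm _ (integrable_cpt (by fun_prop))]
    congr 1; funext ω
    exact (db1 r (s • (ω : EE n))).symm
  have p2 : ∀ r s, ((n : ℝ) - 1) * vs r s + s * vss r s = s * ∫ a : SS n × SS n,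
      ∑ i, T (r • (a.1 : EE n), s • (a.2 : EE n)) (0, EuclideanSpace.single i 1)
        (0, EuclideanSpace.single i 1) ∂((sg n).prod (sg n)) := by
    intro r s
    rw [hvs, hvss]
    simp only
    rw [← integral_const_mul, ← integral_const_mul, ← integral_const_mul,
      ← integral_add (integrable_cpt (by fun_prop)) (integrable_cpt (by fun_prop)),
      integral_prod _ (integrable_cpt (by fun_prop)),
      integral_prod _ (integrable_cpt (by fun_prop))]
    congr 1; funext θ
    exact (db2 s (r • (θ : EE n))).symm
  have hm : ((n - 1 : ℕ) : ℝ) = (n : ℝ) - 1 := by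
    rw [Nat.cast_sub (by omega)]; simp
  have pde : ∀ r s, r * s * vrr r s + ((n - 1 : ℕ) : ℝ) * s * vr r s
      = r * s * vss r s + ((n - 1 : ℕ) : ℝ) * r * vs r s := by
    intro r s
    have h1 := p1 r s
    have h2 := p2 r s
    simp only [hpde] at h1
    rw [hm]
    linear_combination s * h1 - r * h2
  have sw : Continuous fun p : ℝ × ℝ => (p.2, p.1) := by fun_prop
  have key := energy (n - 1) (w := fun r s => v r s - v s r) (wr := fun r s => vr r s - vs s r)
    (ws := fun r s => vs r s - vr s r) (wrr := fun r s => vrr r s - vss s r)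
    (wrs := fun r s => vrs r s - vrs s r) (wss := fun r s => vss r s - vrr s r)
    (cvr.sub (cvs.comp sw)) (cvs.sub (cvr.comp sw)) (cvrr.sub (cvss.comp sw))
    (cvrs.sub (cvrs.comp sw)) (cvss.sub (cvrr.comp sw))
    (fun r s => (dvs r s).sub (dvr s r)) (fun s r => (dvrr r s).sub (dvss s r))
    (fun r s => (dvrs r s).sub (dvsr s r)) (fun s r => (dvsr r s).sub (dvrs s r))
    (fun r s => (dvss r s).sub (dvrr s r))
    (fun r s => by linear_combination pde r s + pde s r)
    (fun r => sub_self _) (fun r => by ring) (fun r => by simp [vs0, vr0]) R hR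
  rw [hv] at key
  simp only [zero_smul] at key
  rw [integral_prod _ (integrable_cpt (by fun_prop)),
    integral_prod_symm _ (integrable_cpt (by fun_prop))] at key
  simp only [integral_const, smul_eq_mul, integral_const_mul] at key
  have hpos : (sg n).real univ ≠ 0 := by
    have : Nonempty (Fin n) := ⟨⟨0, hn⟩⟩
    have : Nontrivial (EE n) := by infer_instance
    have h : sg n ≠ 0 := Measure.toSphere_ne_zero _
    rw [Measure.real, ENNReal.toReal_ne_zero]
    exact ⟨by simpa using h, measure_ne_top _ _⟩
  rw [← mul_sub] at key
  exact sub_eq_zero.1 ((mul_eq_zero.1 key).resolve_left hpos)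

lemma pderiv2 {n : ℕ} (i : Fin n) (f : (Fin n → ℝ) → ℝ) (x : Fin n → ℝ) :
    pderiv' i (pderiv' i f) x = deriv (deriv fun t => f (Function.update x i t)) (x i) := by
  unfold pderiv'
  simp

lemma second_line {n : ℕ} {H : EE n × EE n → ℝ} (hH : ContDiff ℝ 2 H) (p e : EE n × EE n) (t₀ : ℝ) :
    deriv (deriv fun t : ℝ => H (p + (t - t₀) • e)) t₀ = fderiv ℝ (fderiv ℝ H) p e e := by
  have dH : Differentiable ℝ H := hH.differentiable (by norm_num)
  have hD : ContDiff ℝ 1 (fderiv ℝ H) := hH.fderiv_right (by norm_num)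
  have dD : Differentiable ℝ (fderiv ℝ H) := hD.differentiable (by norm_num)
  have hl : ∀ t, HasDerivAt (fun t : ℝ => p + (t - t₀) • e) e t := fun t => by
    simpa using (((hasDerivAt_id t).sub_const t₀).smul_const e).const_add p
  have h1 : (deriv fun t : ℝ => H (p + (t - t₀) • e))
      = fun t => fderiv ℝ H (p + (t - t₀) • e) e := by
    funext t
    exact ((dH _).hasFDerivAt.comp_hasDerivAt t (hl t)).deriv
  rw [h1]
  have h2 : HasDerivAt (fun t => fderiv ℝ H (p + (t - t₀) • e))
      (fderiv ℝ (fderiv ℝ H) (p + (t₀ - t₀) • e) e) t₀ :=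
    (dD _).hasFDerivAt.comp_hasDerivAt t₀ (hl t₀)
  have h3 := h2.clm_apply (hasDerivAt_const t₀ e)
  rw [h3.deriv]
  simp

lemma int_sphereR {n : ℕ} {F : EE n → ℝ} (hF : Continuous F) {r : ℝ} (hr : 0 ≤ r) :
    ∫ θ, F θ ∂(sphereMeasureR n r) = r ^ (n - 1) * ∫ θ : SS n, F (r • (θ : EE n)) ∂(sg n) := by
  unfold sphereMeasureR sphereMeasure
  rw [integral_smul_measure, ENNReal.toReal_ofReal (by positivity),
    integral_map (by fun_prop) hF.aestronglyMeasurable,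
    integral_map (by fun_prop) (by
      exact (hF.comp (continuous_const_smul r)).aestronglyMeasurable)]
  rfl

/-- Classical Asgeirsson mean-value theorem. If `u = u(x,y) ∈ C²(ℝ^n × ℝ^n)`
solves the ultrahyperbolic equation `Δ_x u = Δ_y u`, then for all `x, y ∈ ℝ^n` and `r ≥ 0`,
`∫_{|θ|=r} u(x+θ, y) dS_θ = ∫_{|ω|=r} u(x, y+ω) dS_ω`. -/
theorem classical_asgeirsson
    (n : ℕ) (u : (Fin n → ℝ) → (Fin n → ℝ) → ℝ)
    (hu : ContDiff ℝ 2 (fun p : (Fin n → ℝ) × (Fin n → ℝ) => u p.1 p.2))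
    (hpde : ∀ (x y : Fin n → ℝ),
      lap (fun x' => u x' y) x = lap (fun y' => u x y') y)
    (x y : Fin n → ℝ) (r : ℝ) (hr : 0 ≤ r) :
    ∫ θ, u (fun i => x i + θ i) y ∂(sphereMeasureR n r)
      = ∫ ω, u x (fun j => y j + ω j) ∂(sphereMeasureR n r) := by
  rcases Nat.eq_zero_or_pos n with h0 | hn
  · subst h0
    have : sphereMeasure 0 = 0 := by
      unfold sphereMeasure
      rw [(Measure.toSphere_eq_zero_iff _).2 (by infer_instance)]
      simp
    simp [sphereMeasureR, this]
  let H : EE n × EE n → ℝ := fun p => u (x + p.1.ofLp) (y + p.2.ofLp)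
  have hH : ContDiff ℝ 2 H := by
    have : ContDiff ℝ 2 fun p : EE n × EE n => ((x + p.1.ofLp, y + p.2.ofLp) :
        (Fin n → ℝ) × (Fin n → ℝ)) := by fun_prop
    exact hu.comp this
  have hlap : ∀ p : EE n × EE n, ∑ i, fderiv ℝ (fderiv ℝ H) p (EuclideanSpace.single i 1, 0)
        (EuclideanSpace.single i 1, 0)
      = ∑ i, fderiv ℝ (fderiv ℝ H) p (0, EuclideanSpace.single i 1)
        (0, EuclideanSpace.single i 1) := by
    intro p
    have h := hpde (x + p.1.ofLp) (y + p.2.ofLp)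
    unfold lap at h
    simp only [pderiv2] at h
    have upd : ∀ (z : Fin n → ℝ) (q : EE n) (i : Fin n) (t : ℝ),
        Function.update (z + q.ofLp) i t
          = z + (q + (t - (z + q.ofLp) i) • EuclideanSpace.single i (1:ℝ) : EE n).ofLp := by
      intro z q i t
      ext k
      by_cases hk : k = i
      · subst hk; simp; ring
      · simp [hk]
    have e1 : ∀ i : Fin n, (fun t => u (Function.update (x + p.1.ofLp) i t) (y + p.2.ofLp))
        = fun t => H (p + (t - (x + p.1.ofLp) i) • (EuclideanSpace.single i 1, 0)) := by
      intro i; funext t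
      rw [upd]; simp [H]
    have e2 : ∀ i : Fin n, (fun t => u (x + p.1.ofLp) (Function.update (y + p.2.ofLp) i t))
        = fun t => H (p + (t - (y + p.2.ofLp) i) • (0, EuclideanSpace.single i 1)) := by
      intro i; funext t
      rw [upd]; simp [H]
    simp only [e1, e2, second_line hH] at h
    exact h
  have key := main_sphere hn hH hlap r hr
  have c1 : Continuous fun θ : EE n => H (θ, 0) := hH.continuous.comp (by fun_prop)
  have c2 : Continuous fun θ : EE n => H (0, θ) := hH.continuous.comp (by fun_prop)
  have f1 := int_sphereR c1 hr
  have f2 := int_sphereR c2 hr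
  rw [key, ← f2] at f1
  have g1 : ∀ θ : EE n, u (fun i => x i + θ i) y = H (θ, 0) := fun θ => by
    simp only [H, WithLp.ofLp_zero, add_zero]; rfl
  have g2 : ∀ θ : EE n, u x (fun i => y i + θ i) = H (0, θ) := fun θ => by
    simp only [H, WithLp.ofLp_zero, add_zero]; rfl
  simp only [g1, g2]
  exact f1
end
end
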